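/- arXiv:2006.06371 — 5 statements merged into one kernel-verified Lean document; each statement's English description precedes it below -/
import Mathlib

section
/- Let G be a metabelian group given by a full-rank presentation G = ⟨A ∣ R⟩_M with |A| = n and |R| = m. Then there exist finitely generated subgroups H and K of G such that: (1) H is a free metabelian group of rank max(n − m, 0); (2) K is generated by m elements, K is virtually abelian, and the normal closure L = K^G of K in G is virtually abelian; (3) G is generated by H together with K, and G = L·H, i.e., every element of G is a product of an element of L and an element of H. -/
/-- Exponent sum of the generator `j` in an element of the free group. -/
def expSum {n : ℕ} (j : Fin n) (w : FreeGroup (Fin n)) : ℤ :=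
  Multiplicative.toAdd
    ((FreeGroup.lift fun i => Multiplicative.ofAdd (if i = j then (1 : ℤ) else 0)) w)

/-- The relation matrix `M(A,R)` of a presentation with `n` generators and `m` relators:
its `(i,j)` entry is the exponent sum of `a_j` in `r_i`. -/
def relMatrix {n m : ℕ} (R : Fin m → FreeGroup (Fin n)) : Matrix (Fin m) (Fin n) ℤ :=
  fun i j => expSum j (R i)

instance derivedSeriesNormal {G : Type*} [Group G] (k : ℕ) : (derivedSeries G k).Normal :=
  derivedSeries_normal G k

/-- The normal subgroup `N · F''` of the free group determined by the relators `R`,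
where `N` is the normal closure of `R` and `F''` is the second derived subgroup. -/
def metabelianRel {n : ℕ} (R : Set (FreeGroup (Fin n))) : Subgroup (FreeGroup (Fin n)) :=
  Subgroup.normalClosure (R ∪ (derivedSeries (FreeGroup (Fin n)) 2 : Subgroup (FreeGroup (Fin n))))

instance {n : ℕ} (R : Set (FreeGroup (Fin n))) : (metabelianRel R).Normal :=
  Subgroup.normalClosure_normal

/-- The metabelian group presented by `⟨A ∣ R⟩_M`, i.e. `F(A)/(N·F(A)'')`. -/
abbrev MetabelianPresented {n : ℕ} (R : Set (FreeGroup (Fin n))) : Type :=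
  FreeGroup (Fin n) ⧸ metabelianRel R

/-- The free metabelian group of rank `k`: the quotient of the free group of rank `k`
by its second derived subgroup. -/
abbrev FreeMetabelian (k : ℕ) : Type :=
  FreeGroup (Fin k) ⧸ derivedSeries (FreeGroup (Fin k)) 2

/-- A group is virtually abelian if it has an abelian subgroup of finite index. -/
def VirtuallyAbelian (G : Type*) [Group G] : Prop :=
  ∃ H : Subgroup G, (∀ x ∈ H, ∀ y ∈ H, x * y = y * x) ∧ H.FiniteIndex

section FoxCalculus

variable {X S V : Type*} [CommRing S] [AddCommGroup V] [Module S V]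

/-- The affine action attached to a twist `σ` and values `v` on the generators. -/
def affHom (σ : FreeGroup X →* Sˣ) (v : X → V) : FreeGroup X →* Equiv.Perm V :=
  FreeGroup.lift fun x => (MulAction.toPerm (σ (FreeGroup.of x))).trans (Equiv.addRight (v x))

/-- The `σ`-derivation of the free group with prescribed values on generators. -/
def foxD (σ : FreeGroup X →* Sˣ) (v : X → V) (w : FreeGroup X) : V := affHom σ v w 0

lemma affHom_of (σ : FreeGroup X →* Sˣ) (v : X → V) (x : X) (y : V) :
    affHom σ v (FreeGroup.of x) y = σ (FreeGroup.of x) • y + v x := by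
  simp [affHom]

lemma affHom_apply (σ : FreeGroup X →* Sˣ) (v : X → V) (w : FreeGroup X) :
    ∀ y : V, affHom σ v w y = σ w • y + foxD σ v w := by
  induction w using FreeGroup.induction_on with
  | C1 => intro y; simp [foxD]
  | of x => intro y; simp [foxD, affHom_of]
  | inv_of x ih =>
    intro y
    rw [map_inv, Equiv.Perm.inv_eq_iff_eq, foxD, map_inv]
    rw [ih, smul_add, map_inv, smul_inv_smul, add_assoc]
    have := ih ((affHom σ v (FreeGroup.of x))⁻¹ 0)
    rw [← Equiv.Perm.mul_apply, mul_inv_cancel, Equiv.Perm.one_apply] at this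
    rw [← this, add_zero]
  | mul a b iha ihb =>
    intro y
    simp only [foxD, map_mul, Equiv.Perm.mul_apply]
    rw [ihb, iha, iha (affHom σ v b 0)]
    simp [foxD, smul_add, mul_smul, add_assoc]

lemma foxD_of (σ : FreeGroup X →* Sˣ) (v : X → V) (x : X) :
    foxD σ v (FreeGroup.of x) = v x := by
  simp [foxD, affHom_of]

lemma foxD_mul (σ : FreeGroup X →* Sˣ) (v : X → V) (a b : FreeGroup X) :
    foxD σ v (a * b) = foxD σ v a + σ a • foxD σ v b := by
  conv_lhs => rw [foxD, map_mul, Equiv.Perm.mul_apply, affHom_apply]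
  rw [add_comm]; rfl

/-- Derivations are determined by their values on generators. -/
lemma deriv_ext (σ : FreeGroup X →* Sˣ) (d e : FreeGroup X → V)
    (hd : ∀ a b, d (a * b) = d a + σ a • d b) (he : ∀ a b, e (a * b) = e a + σ a • e b)
    (h : ∀ x, d (FreeGroup.of x) = e (FreeGroup.of x)) (w : FreeGroup X) : d w = e w := by
  have hd1 : d 1 = 0 := by simpa using hd 1 1
  have he1 : e 1 = 0 := by simpa using he 1 1
  induction w using FreeGroup.induction_on with
  | C1 => rw [hd1, he1]
  | of x => exact h x
  | inv_of x ih =>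
    have h1 := hd (FreeGroup.of x) (FreeGroup.of x)⁻¹
    have h2 := he (FreeGroup.of x) (FreeGroup.of x)⁻¹
    rw [mul_inv_cancel, hd1] at h1
    rw [mul_inv_cancel, he1, ← ih, h1] at h2
    exact (smul_left_cancel _ (add_left_cancel h2))
  | mul a b iha ihb => rw [hd, he, iha, ihb]

lemma derived_le_ker_affHom (σ : FreeGroup X →* Sˣ) (v : X → V) :
    derivedSeries (FreeGroup X) 2 ≤ (affHom σ v).ker := by
  have h1 : ∀ g ∈ derivedSeries (FreeGroup X) 1, σ g = 1 := fun g hg => by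
    rw [derivedSeries_one] at hg
    exact Abelianization.commutator_subset_ker σ hg
  rw [show derivedSeries (FreeGroup X) 2 = ⁅derivedSeries (FreeGroup X) 1,
    derivedSeries (FreeGroup X) 1⁆ from rfl, Subgroup.commutator_le]
  intro g hg k hk
  rw [MonoidHom.mem_ker, map_commutatorElement, commutatorElement_eq_one_iff_mul_comm]
  ext y
  simp only [Equiv.Perm.mul_apply, affHom_apply, h1 g hg, h1 k hk, one_smul]
  abel

lemma foxD_eq_sum [Fintype X] [DecidableEq X] (σ : FreeGroup X →* Sˣ) (v : X → V)
    (w : FreeGroup X) :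
    foxD σ v w = ∑ x, foxD σ (Pi.single x (1 : S)) w • v x := by
  refine deriv_ext σ (foxD σ v) (fun w => ∑ x, foxD σ (Pi.single x (1 : S)) w • v x)
    (foxD_mul σ v) ?_ ?_ w
  · intro a b
    simp only [foxD_mul, add_smul, Finset.sum_add_distrib, Finset.smul_sum, Units.smul_def,
      smul_eq_mul, mul_smul]
  · intro x
    simp only [foxD_of]
    rw [Finset.sum_eq_single x]
    · simp
    · intro y _ hy
      simp [hy.symm]
    · simp

end FoxCalculus

section Magnus

variable {β : Type*}

/-- The group ring of the free abelian group. -/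
abbrev GR (β : Type*) : Type _ := MonoidAlgebra ℤ (Abelianization (FreeGroup β))

instance uniqueProdsAb : UniqueProds (Abelianization (FreeGroup β)) := by
  have h : UniqueSums (FreeAbelianGroup β) := inferInstance
  have h2 : UniqueProds (Multiplicative (FreeAbelianGroup β)) := inferInstance
  exact h2

/-- The canonical unit of the group ring. -/
noncomputable def unitOf : Abelianization (FreeGroup β) →* (GR β)ˣ :=
  (Units.map (MonoidAlgebra.of ℤ (Abelianization (FreeGroup β)))).comp
    (toUnits : Abelianization (FreeGroup β) ≃* _).toMonoidHom

lemma unitOf_val (g : Abelianization (FreeGroup β)) :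
    ((unitOf g : (GR β)ˣ) : GR β) = MonoidAlgebra.single g 1 := rfl

lemma unitOf_injective : Function.Injective (unitOf (β := β)) := by
  intro a b h
  have := congrArg (fun u : (GR β)ˣ => (u : GR β)) h
  exact MonoidAlgebra.of_injective this

/-- The canonical twist on the free group. -/
noncomputable def sig : FreeGroup β →* (GR β)ˣ := unitOf.comp Abelianization.of

/-- a transversal -/
noncomputable def tr (g : Abelianization (FreeGroup β)) : FreeGroup β := Quotient.out g

lemma of_tr (g : Abelianization (FreeGroup β)) : Abelianization.of (tr g) = g :=
  Quotient.out_eq g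

/-- Schreier-type elements. -/
noncomputable def sch (g : Abelianization (FreeGroup β)) (w : FreeGroup β) :
    commutator (FreeGroup β) :=
  ⟨tr g * w * (tr (g * Abelianization.of w))⁻¹, by
    rw [← Abelianization.ker_of, MonoidHom.mem_ker]
    simp [of_tr]⟩

variable [Fintype β] [DecidableEq β]

/-- The universal derivation. -/
noncomputable def chain (w : FreeGroup β) : β → GR β :=
  foxD (sig (β := β)) (fun b => (Pi.single b 1 : β → GR β)) w

/-- Evaluation of chains in the abelianization of the commutator subgroup. -/
noncomputable def evalChain : (β → GR β) →+
    Additive (Abelianization (commutator (FreeGroup β))) :=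
  ∑ b : β, ((Finsupp.liftAddHom fun g => zmultiplesHom _
      (Additive.ofMul (Abelianization.of (sch g (FreeGroup.of b))))).comp
    (MonoidAlgebra.coeffAddEquiv (R := ℤ) (M := Abelianization (FreeGroup β))).toAddMonoidHom).comp
      (Pi.evalAddMonoidHom (fun _ : β => GR β) b)

lemma evalChain_single (g : Abelianization (FreeGroup β)) (b : β) :
    evalChain (unitOf g • (Pi.single b 1 : β → GR β)) =
      Additive.ofMul (Abelianization.of (sch g (FreeGroup.of b))) := by
  rw [evalChain, AddMonoidHom.finsetSum_apply, Finset.sum_eq_single b]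
  · simp [Units.smul_def, unitOf_val, MonoidAlgebra.coeff_single]
  · intro c _ hc
    simp [hc, Units.smul_def]
  · simp

lemma evalChain_chain (w : FreeGroup β) : ∀ g : Abelianization (FreeGroup β),
    evalChain (unitOf g • chain w) = Additive.ofMul (Abelianization.of (sch g w)) := by
  have hmul : ∀ (g : Abelianization (FreeGroup β)) (u v : FreeGroup β),
      sch g (u * v) = sch g u * sch (g * Abelianization.of u) v := by
    intro g u v
    ext
    simp [sch, mul_assoc]
  have cmul : ∀ (g : Abelianization (FreeGroup β)) (u v : FreeGroup β),
      unitOf g • chain (u * v) = unitOf g • chain u +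
        unitOf (g * Abelianization.of u) • chain v := by
    intro g u v
    rw [chain, foxD_mul, smul_add, map_mul, mul_smul]
    rfl
  have c1 : chain (1 : FreeGroup β) = 0 := by simp [chain, foxD]
  have s1 : ∀ g : Abelianization (FreeGroup β), sch g 1 = 1 := by
    intro g; ext; simp [sch]
  induction w using FreeGroup.induction_on with
  | C1 => intro g; rw [c1, s1]; simp
  | of x => intro g; rw [chain, foxD_of, evalChain_single]
  | inv_of x ih =>
    intro g
    have h1 := cmul (g * Abelianization.of (FreeGroup.of x)⁻¹) (FreeGroup.of x) (FreeGroup.of x)⁻¹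
    have h2 := hmul (g * Abelianization.of (FreeGroup.of x)⁻¹) (FreeGroup.of x) (FreeGroup.of x)⁻¹
    rw [mul_inv_cancel, c1, smul_zero] at h1
    rw [mul_inv_cancel, s1] at h2
    have e : g * Abelianization.of (FreeGroup.of x)⁻¹ * Abelianization.of (FreeGroup.of x) = g := by
      simp
    rw [e] at h1 h2
    have h3 := congrArg evalChain h1
    rw [map_zero, map_add, ih] at h3
    have h4 := congrArg (fun z => Additive.ofMul (Abelianization.of z)) h2
    simp only [map_one, map_mul, ofMul_one, ofMul_mul] at h4
    rw [h4] at h3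
    simp only [map_inv] at h3 ⊢
    exact (add_left_cancel h3).symm
  | mul a b iha ihb =>
    intro g
    rw [cmul, map_add, iha, ihb, hmul, map_mul, ofMul_mul]

/-- Faithfulness of the Magnus embedding. -/
lemma magnus_faithful (w : FreeGroup β) (hw : Abelianization.of w = 1) (hc : chain w = 0) :
    w ∈ derivedSeries (FreeGroup β) 2 := by
  have h := evalChain_chain w 1
  rw [hc, smul_zero, map_zero] at h
  have h' : Abelianization.of (sch 1 w) = 1 := by
    have := congrArg Additive.toMul h
    simpa using this.symm
  rw [← MonoidHom.mem_ker, Abelianization.ker_of] at h'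
  have h2 : ((sch 1 w : commutator (FreeGroup β)) : FreeGroup β) ∈
      derivedSeries (FreeGroup β) 2 := by
    have := Subgroup.mem_map_of_mem (commutator (FreeGroup β)).subtype h'
    rw [commutator_def (commutator (FreeGroup β)), Subgroup.map_commutator] at this
    rw [show derivedSeries (FreeGroup β) 2 = ⁅derivedSeries (FreeGroup β) 1,
      derivedSeries (FreeGroup β) 1⁆ from rfl, derivedSeries_one]
    simpa [← MonoidHom.range_eq_map] using this
  have h3 : ((sch 1 w : commutator (FreeGroup β)) : FreeGroup β) =
      tr 1 * w * (tr 1)⁻¹ := by simp [sch, hw]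
  rw [h3] at h2
  have h4 := (derivedSeriesNormal 2).conj_mem _ h2 (tr (1 : Abelianization (FreeGroup β)))⁻¹
  simpa only [mul_assoc, inv_inv, inv_mul_cancel, mul_one, inv_mul_cancel_left] using h4

end Magnus

section Exponents

variable {X : Type*} [DecidableEq X]

/-- Exponent sum homomorphism over a general alphabet. -/
def xsHom (j : X) : FreeGroup X →* Multiplicative ℤ :=
  FreeGroup.lift fun i => Multiplicative.ofAdd (if i = j then (1 : ℤ) else 0)

/-- Exponent sum over a general alphabet. -/
def xs (j : X) (w : FreeGroup X) : ℤ := Multiplicative.toAdd (xsHom j w)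

lemma xs_mul (j : X) (u v : FreeGroup X) : xs j (u * v) = xs j u + xs j v := by
  simp [xs]

lemma xs_inv (j : X) (u : FreeGroup X) : xs j u⁻¹ = - xs j u := by
  simp [xs]

lemma xs_one (j : X) : xs j (1 : FreeGroup X) = 0 := by
  simp [xs]

lemma xs_of (j x : X) : xs j (FreeGroup.of x) = if x = j then 1 else 0 := by
  simp [xs, xsHom]

lemma xs_hom [Fintype X] {C : Type*} [CommGroup C] (f : FreeGroup X →* C) (w : FreeGroup X) :
    f w = ∏ x, f (FreeGroup.of x) ^ xs x w := by
  induction w using FreeGroup.induction_on with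
  | C1 => simp [xs_one]
  | of y => simp [xs_of, pow_ite]
  | inv_of y ih => 
    simp only [xs_inv, zpow_neg, Finset.prod_inv_distrib, map_inv]
    rw [← ih]
  | mul a b iha ihb => simp only [xs_mul, zpow_add, Finset.prod_mul_distrib, map_mul, ← iha, ← ihb]

end Exponents

section Freeness

variable {α β : Type*}

/-- Projection killing the first batch of generators. -/
def prB : FreeGroup (α ⊕ β) →* FreeGroup β :=
  FreeGroup.lift (Sum.elim (fun _ => 1) FreeGroup.of)

lemma prB_map (w : FreeGroup β) : prB (FreeGroup.map (Sum.inr : β → α ⊕ β) w) = w := by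
  have : (prB (α := α) (β := β)).comp (FreeGroup.map (Sum.inr : β → α ⊕ β)) = MonoidHom.id _ := by
    ext b; simp [prB]
  exact DFunLike.congr_fun this w

/-- The augmentation. -/
noncomputable def aug : GR β →+* ℤ :=
  (MonoidAlgebra.lift ℤ ℤ (Abelianization (FreeGroup β)) 1).toRingHom

lemma aug_unitOf (g : Abelianization (FreeGroup β)) : aug ((unitOf g : (GR β)ˣ) : GR β) = 1 := by
  simp [aug, unitOf_val]

variable [Fintype α] [DecidableEq α] [Fintype β] [DecidableEq β]

lemma freeness (R : α → FreeGroup (α ⊕ β))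
    (hβ : ∀ i b, xs (Sum.inr b) (R i) = 0)
    (hdet : (Matrix.of fun i j => xs (Sum.inl j) (R i) : Matrix α α ℤ).det ≠ 0)
    (w : FreeGroup β)
    (hw : FreeGroup.map (Sum.inr : β → α ⊕ β) w ∈
      Subgroup.normalClosure (Set.range R ∪
        (derivedSeries (FreeGroup (α ⊕ β)) 2 : Subgroup (FreeGroup (α ⊕ β))))) :
    w ∈ derivedSeries (FreeGroup β) 2 := by
  classical
  let σ : FreeGroup (α ⊕ β) →* (GR β)ˣ := (sig (β := β)).comp prB
  have hσR : ∀ i, σ (R i) = 1 := by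
    intro i
    rw [xs_hom σ (R i), Fintype.prod_sum_type]
    simp [hβ, σ, prB]
  let fd : α ⊕ β → FreeGroup (α ⊕ β) → GR β := fun x => foxD σ (Pi.single x (1 : GR β))
  have haug : ∀ x u, aug (fd x u) = xs x u := by
    intro x u
    refine deriv_ext (S := ℤ) (V := ℤ) 1 (fun u => aug (fd x u)) (xs x) ?_ ?_ ?_ u
    · intro a b
      simp only [fd, foxD_mul, map_add, Units.smul_def, smul_eq_mul, map_mul]
      rw [show aug ((σ a : (GR β)ˣ) : GR β) = 1 from aug_unitOf _]
      simp
    · intro a b; simp [xs_mul]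
    · intro y
      simp only [fd, foxD_of, xs_of, Pi.single_apply]
      split_ifs <;> simp
  let D : Matrix α α (GR β) := Matrix.of fun i j => fd (Sum.inl j) (R i)
  let D' : Matrix α β (GR β) := Matrix.of fun i b => fd (Sum.inr b) (R i)
  have hD : D.det ≠ 0 := by
    intro h
    apply hdet
    have := congrArg aug h
    rw [map_zero, RingHom.map_det] at this
    rw [← this]
    congr 1
    ext i j
    simp [D, haug]
  let v : α ⊕ β → (β → GR β) := Sum.elim (fun j b => - (D.adjugate * D') j b)
    (fun b => D.det • Pi.single b 1)
  have hR : ∀ i, foxD σ v (R i) = 0 := by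
    intro i
    rw [foxD_eq_sum, Fintype.sum_sum_type]
    ext b
    have key : (D * (D.adjugate * D')) i b = D.det * D' i b := by
      rw [← Matrix.mul_assoc, Matrix.mul_adjugate]; simp
    rw [Matrix.mul_apply] at key
    simp only [Pi.add_apply, Finset.sum_apply, Pi.smul_apply, smul_eq_mul, v, Sum.elim_inl,
      Sum.elim_inr, mul_neg, Finset.sum_neg_distrib, Pi.zero_apply]
    have e1 : ∑ x, foxD σ (Pi.single (Sum.inl x) (1 : GR β)) (R i) * (D.adjugate * D') x b =
      D.det * D' i b := key
    rw [e1, Finset.sum_eq_single b]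
    · simp [D', fd, mul_comm]
    · intro c _ hc
      simp [hc.symm]
    · simp
  have hker : Subgroup.normalClosure (Set.range R ∪
        (derivedSeries (FreeGroup (α ⊕ β)) 2 : Subgroup (FreeGroup (α ⊕ β)))) ≤
        (affHom σ v).ker := by
    apply Subgroup.normalClosure_le_normal
    apply Set.union_subset
    · rintro _ ⟨i, rfl⟩
      rw [SetLike.mem_coe, MonoidHom.mem_ker]
      ext1 y
      rw [affHom_apply, hR, hσR]; simp
    · exact derived_le_ker_affHom σ v
  have hw' : affHom σ v (FreeGroup.map Sum.inr w) = 1 := hker hw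
  have hd : ∀ u : FreeGroup β, foxD σ v (FreeGroup.map Sum.inr u) = D.det • chain u := by
    have hs : ∀ u : FreeGroup β, σ (FreeGroup.map Sum.inr u) = sig u := by
      intro u; simp [σ, prB_map]
    refine deriv_ext sig _ _ ?_ ?_ ?_
    · intro a b
      rw [map_mul, foxD_mul, hs]
    · intro a b
      rw [chain, foxD_mul, smul_add, smul_comm]; rfl
    · intro b
      simp only [FreeGroup.map.of, foxD_of, chain]; rfl
  have hc : chain w = 0 := by
    have h0 : foxD σ v (FreeGroup.map Sum.inr w) = 0 := by rw [foxD, hw']; rfl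
    rw [hd] at h0
    ext1 b
    have := congrFun h0 b
    simpa [hD] using this
  have hab : Abelianization.of w = 1 := by
    -- the fundamental formula
    have hf : ∀ u : FreeGroup β, ((sig u : (GR β)ˣ) : GR β) - 1 =
        foxD (sig (β := β)) (fun b => ((sig (FreeGroup.of b) : (GR β)ˣ) : GR β) - 1) u := by
      refine deriv_ext sig _ _ ?_ (foxD_mul _ _) ?_
      · intro a b
        simp only [map_mul, Units.val_mul, Units.smul_def, smul_eq_mul]; ring
      · intro b; rw [foxD_of]
    have hz : ∀ b, foxD (sig (β := β)) (Pi.single b (1 : GR β)) w = 0 := by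
      intro b
      have : ∀ u : FreeGroup β, chain u b = foxD (sig (β := β)) (Pi.single b (1 : GR β)) u := by
        refine deriv_ext sig _ _ ?_ (foxD_mul _ _) ?_
        · intro x y
          rw [chain, foxD_mul]; rfl
        · intro x
          simp only [foxD_of, chain, Pi.single_apply, eq_comm]
      rw [← this, hc]; rfl
    have h1 := hf w
    rw [foxD_eq_sum] at h1
    simp only [hz, zero_smul, Finset.sum_const_zero, sub_eq_zero] at h1
    have h2 : unitOf (Abelianization.of w) = unitOf 1 := by
      rw [map_one]; exact Units.ext h1
    exact unitOf_injective h2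
  exact magnus_faithful w hab hc

end Freeness

section Nielsen

variable {X Y : Type*} [DecidableEq X] [DecidableEq Y]

lemma xs_congr (e : X ≃ Y) (x : X) (w : FreeGroup Y) :
    xs x ((FreeGroup.freeGroupCongr e).symm w) = xs (e x) w := by
  have : (xsHom x).comp (FreeGroup.freeGroupCongr e).symm.toMonoidHom = xsHom (e x) := by
    ext y
    simp [xsHom, Equiv.symm_apply_eq]
  exact congrArg Multiplicative.toAdd (DFunLike.congr_fun this w)

/-- Elementary Nielsen homomorphism `a ↦ a b^ε`. -/
def transHom (a b : X) (ε : ℤ) : FreeGroup X →* FreeGroup X :=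
  FreeGroup.lift fun x => if x = a then FreeGroup.of a * FreeGroup.of b ^ ε else FreeGroup.of x

lemma transHom_comp (a b : X) (hab : a ≠ b) (ε : ℤ) :
    (transHom a b (-ε)).comp (transHom a b ε) = MonoidHom.id _ := by
  ext x
  by_cases h : x = a
  · subst h
    simp [transHom, hab.symm]
  · simp [transHom, h]

/-- Elementary Nielsen automorphism. -/
def transEquiv (a b : X) (hab : a ≠ b) (ε : ℤ) : FreeGroup X ≃* FreeGroup X :=
  MonoidHom.toMulEquiv (transHom a b ε) (transHom a b (-ε)) (transHom_comp a b hab ε)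
    (by simpa using transHom_comp a b hab (-ε))

lemma xs_trans (a b : X) (hab : a ≠ b) (ε : ℤ) (j : X) (w : FreeGroup X) :
    xs j (transEquiv a b hab ε w) = xs j w + if j = b then ε * xs a w else 0 := by
  change xs j (transHom a b ε w) = _
  induction w using FreeGroup.induction_on with
  | C1 => simp [xs_one]
  | of x =>
    have hz : xs j (FreeGroup.of b ^ ε) = if j = b then ε else 0 := by
      by_cases h : j = b
      · simp [xs, xsHom, h]
      · simp [xs, xsHom, h, Ne.symm h]
    by_cases h : x = a
    · subst h
      simp [transHom, xs_mul, hz, xs_of]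
    · simp [transHom, h, xs_of]
  | inv_of x ih =>
    rw [map_inv, xs_inv, ih, xs_inv, xs_inv]
    split_ifs <;> ring
  | mul u v hu hv =>
    rw [map_mul, xs_mul, hu, hv, xs_mul, xs_mul]
    split_ifs <;> ring

lemma nielsen_row {n m : ℕ} (R : Fin m → FreeGroup (Fin n)) (k : Fin m) :
    ∀ (N : ℕ) (θ : FreeGroup (Fin n) ≃* FreeGroup (Fin n)),
      (∀ i : Fin m, i < k → ∀ j : Fin n, i.val < j.val → xs j (θ (R i)) = 0) →
      (∑ j : Fin n, if k.val ≤ j.val then (xs j (θ (R k))).natAbs else 0) = N →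
      ∃ θ' : FreeGroup (Fin n) ≃* FreeGroup (Fin n),
        (∀ i : Fin m, i ≤ k → ∀ j : Fin n, i.val < j.val → xs j (θ' (R i)) = 0) := by
  intro N
  induction N using Nat.strong_induction_on with
  | _ N ih =>
  intro θ hθ hN
  by_cases h2 : ∃ a b : Fin n, a ≠ b ∧ k.val ≤ a.val ∧ k.val ≤ b.val ∧ xs a (θ (R k)) ≠ 0 ∧
      xs b (θ (R k)) ≠ 0 ∧ (xs a (θ (R k))).natAbs ≤ (xs b (θ (R k))).natAbs
  · obtain ⟨a, b, hab, hka, hkb, ha0, hb0, hle⟩ := h2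
    obtain ⟨ε, hε⟩ : ∃ ε : ℤ, (xs b (θ (R k)) + ε * xs a (θ (R k))).natAbs <
        (xs b (θ (R k))).natAbs := by
      rcases lt_or_gt_of_ne ha0 with h | h <;> rcases lt_or_gt_of_ne hb0 with h' | h'
      · exact ⟨-1, by omega⟩
      · exact ⟨1, by omega⟩
      · exact ⟨1, by omega⟩
      · exact ⟨-1, by omega⟩
    refine ih _ ?_ (θ.trans (transEquiv a b hab ε)) ?_ rfl
    · rw [← hN]
      apply Finset.sum_lt_sum
      · intro j _
        by_cases hj : j = b
        · subst hj
          simp only [MulEquiv.trans_apply, xs_trans, if_true, hkb]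
          exact hε.le
        · simp [xs_trans, hj]
      · refine ⟨b, Finset.mem_univ _, ?_⟩
        simp only [MulEquiv.trans_apply, xs_trans, if_true, hkb]
        exact hε
    · intro i hi j hj
      have hi' : i.val < k.val := hi
      rw [MulEquiv.trans_apply, xs_trans, hθ i hi j hj, hθ i hi a (by omega)]
      simp
  · push Not at h2
    by_cases h3 : ∃ c : Fin n, k.val < c.val ∧ xs c (θ (R k)) ≠ 0
    · obtain ⟨c, hkc, hc⟩ := h3
      let k' : Fin n := ⟨k.val, by omega⟩
      have hz : ∀ j : Fin n, k.val ≤ j.val → j ≠ c → xs j (θ (R k)) = 0 := by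
        intro j hj hjc
        by_contra h0
        have e1 := h2 j c hjc hj hkc.le h0 hc
        have e2 := h2 c j hjc.symm hkc.le hj hc h0
        omega
      refine ⟨θ.trans (FreeGroup.freeGroupCongr (Equiv.swap k' c)).symm, ?_⟩
      intro i hi j hj
      have hi' : i.val ≤ k.val := hi
      rw [MulEquiv.trans_apply, xs_congr]
      rcases lt_or_eq_of_le hi with h | h
      · have h' : i.val < k.val := h
        apply hθ i h
        rw [Equiv.swap_apply_def]
        split_ifs with h1 h1
        · omega
        · exact h'
        · exact hj
      · subst h
        have hjk : j ≠ k' := fun h => by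
          rw [h] at hj; exact lt_irrefl _ hj
        rw [Equiv.swap_apply_def, if_neg hjk]
        split_ifs with h1
        · exact hz k' le_rfl (fun h => by rw [← h] at hkc; exact lt_irrefl _ hkc)
        · exact hz j hj.le h1
    · push Not at h3
      refine ⟨θ, ?_⟩
      intro i hi j hj
      rcases lt_or_eq_of_le hi with h | h
      · exact hθ i h j hj
      · subst h
        exact h3 j hj

lemma nielsen {n m : ℕ} (R : Fin m → FreeGroup (Fin n)) :
    ∃ θ : FreeGroup (Fin n) ≃* FreeGroup (Fin n),
      ∀ (i : Fin m) (j : Fin n), i.val < j.val → xs j (θ (R i)) = 0 := by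
  have h : ∀ k : ℕ, k ≤ m → ∃ θ : FreeGroup (Fin n) ≃* FreeGroup (Fin n),
      ∀ (i : Fin m), i.val < k → ∀ (j : Fin n), i.val < j.val → xs j (θ (R i)) = 0 := by
    intro k
    induction k with
    | zero => intro _; exact ⟨MulEquiv.refl _, fun i hi => absurd hi (by omega)⟩
    | succ k ih =>
      intro hk
      obtain ⟨θ, hθ⟩ := ih (by omega)
      obtain ⟨θ', h'⟩ := nielsen_row R ⟨k, by omega⟩ _ θ (fun i hi => hθ i hi) rfl
      exact ⟨θ', fun i hi => h' i (Nat.lt_succ_iff.1 hi)⟩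
  obtain ⟨θ, hθ⟩ := h m le_rfl
  exact ⟨θ, fun i => hθ i i.2⟩

end Nielsen

section LinAlg

lemma mulVec_inj_of_rank {ι κ : Type*} [Fintype ι] [Fintype κ] [DecidableEq κ]
    (M : Matrix ι κ ℤ) (h : M.rank = Fintype.card κ) (x : κ → ℤ) (hx : M.mulVec x = 0) :
    x = 0 := by
  have h1 := Submodule.finrank_quotient_add_finrank (LinearMap.ker M.mulVecLin)
  rw [(M.mulVecLin.quotKerEquivRange).finrank_eq, Module.finrank_fintype_fun_eq_card] at h1
  have h2 : Module.finrank ℤ (LinearMap.ker M.mulVecLin) = 0 := by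
    rw [Matrix.rank] at h; omega
  rw [Submodule.finrank_eq_zero] at h2
  have : x ∈ LinearMap.ker M.mulVecLin := by simpa using hx
  rw [h2] at this
  simpa using this

lemma det_ne_zero_of_rank {κ : Type*} [Fintype κ] [DecidableEq κ]
    (M : Matrix κ κ ℤ) (h : M.rank = Fintype.card κ) : M.det ≠ 0 := by
  intro h0
  obtain ⟨v, hv, hv0⟩ := Matrix.exists_mulVec_eq_zero_iff.2 h0
  exact hv (mulVec_inj_of_rank M h v hv0)

lemma exists_left_inv {ι κ : Type*} [Fintype ι] [Fintype κ] [DecidableEq κ]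
    (M : Matrix ι κ ℤ) (h : M.rank = Fintype.card κ) :
    ∃ (P : Matrix κ ι ℤ) (N : ℤ), N ≠ 0 ∧ P * M = N • (1 : Matrix κ κ ℤ) := by
  refine ⟨(M.transpose * M).adjugate * M.transpose, (M.transpose * M).det, ?_, ?_⟩
  · intro h0
    obtain ⟨v, hv, hv0⟩ := Matrix.exists_mulVec_eq_zero_iff.2 h0
    apply hv
    apply mulVec_inj_of_rank M h
    have h1 : dotProduct (M.mulVec v) (M.mulVec v) = 0 := by
      rw [Matrix.dotProduct_mulVec, Matrix.vecMul_mulVec, ← Matrix.dotProduct_mulVec, hv0,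
        dotProduct_zero]
    exact dotProduct_self_eq_zero.1 h1
  · rw [Matrix.mul_assoc, Matrix.adjugate_mul]

lemma zpow_finset_sum' {ι C : Type*} [CommGroup C] (c : C) (f : ι → ℤ) (t : Finset ι) :
    c ^ (∑ i ∈ t, f i) = ∏ i ∈ t, c ^ f i := by
  classical
  induction t using Finset.induction_on with
  | empty => simp
  | insert a t ha ih => rw [Finset.sum_insert ha, Finset.prod_insert ha, zpow_add, ih]

lemma torsion_of_left_inv {ι X G : Type*} [Fintype ι] [Fintype X] [DecidableEq X]
    {Y : Type*} [Fintype Y] [DecidableEq Y] (g : Y → X) (hg : Function.Injective g)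
    [Group G] (q : FreeGroup X →* G) (R : ι → FreeGroup X) (hq : ∀ i, q (R i) = 1)
    (hR : ∀ i x, x ∉ Set.range g → xs x (R i) = 0)
    (hM : (Matrix.of fun i y => xs (g y) (R i) : Matrix ι Y ℤ).rank = Fintype.card Y) (y : Y) :
    IsOfFinOrder (Abelianization.of (q (FreeGroup.of (g y)))) := by
  obtain ⟨P, N, hN, hP⟩ := exists_left_inv _ hM
  let f : FreeGroup X →* Abelianization G := Abelianization.of.comp q
  have h1 : ∀ i, ∏ z, f (FreeGroup.of (g z)) ^ xs (g z) (R i) = 1 := by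
    intro i
    have h2 : f (R i) = 1 := by simp [f, hq]
    rw [xs_hom] at h2
    rw [← h2]
    refine Finset.prod_of_injOn g hg.injOn (by simp) ?_ (by simp)
    intro x _ hx
    rw [hR i x (by simpa using hx), zpow_zero]
  have h2 : f (FreeGroup.of (g y)) ^ N = 1 := by
    calc f (FreeGroup.of (g y)) ^ N
        = ∏ z, f (FreeGroup.of (g z)) ^ (N • (1 : Matrix Y Y ℤ)) y z := by
          rw [Finset.prod_eq_single y]
          · simp
          · intro z _ hz
            simp [Matrix.one_apply_ne' hz]
          · simp
      _ = ∏ z, ∏ i, (f (FreeGroup.of (g z)) ^ xs (g z) (R i)) ^ P y i := by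
          rw [← hP]
          refine Finset.prod_congr rfl fun z _ => ?_
          rw [Matrix.mul_apply, zpow_finset_sum']
          refine Finset.prod_congr rfl fun i _ => ?_
          rw [Matrix.of_apply, mul_comm, zpow_mul]
      _ = 1 := by
          rw [Finset.prod_comm]
          refine Finset.prod_eq_one fun i _ => ?_
          rw [Finset.prod_zpow, h1, one_zpow]
  exact isOfFinOrder_iff_zpow_eq_one.2 ⟨N, hN, h2⟩

end LinAlg

section VA

lemma va_of_finite_image {G : Type*} [Group G]
    (hmet : ∀ x ∈ commutator G, ∀ y ∈ commutator G, x * y = y * x)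
    {m : ℕ} (s : Fin m → G) (hs : ∀ i, IsOfFinOrder (Abelianization.of (s i)))
    (L : Subgroup G) (hL : L ≤ (Subgroup.closure (Set.range fun i =>
      Abelianization.of (s i))).comap Abelianization.of) : VirtuallyAbelian L := by
  let C : Subgroup (Abelianization G) := Subgroup.closure (Set.range fun i =>
      Abelianization.of (s i))
  have hC : C ≤ CommGroup.torsion _ := by
    rw [Subgroup.closure_le]
    rintro _ ⟨i, rfl⟩
    exact hs i
  have hfg : C.FG := ⟨(Set.finite_range fun i => Abelianization.of (s i)).toFinset, by simp [C]⟩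
  have hCfin : Finite C := by
    have : Group.FG C := (Group.fg_iff_subgroup_fg C).2 hfg
    apply CommGroup.finite_of_fg_isMulTorsion
    intro x
    have := hC x.2
    exact Submonoid.isOfFinOrder_coe.1 this
  let f : L →* Abelianization G := Abelianization.of.comp L.subtype
  have hf : f.range ≤ C := by
    rintro _ ⟨x, rfl⟩
    exact hL x.2
  have : Finite f.range := Finite.of_injective _ (Subgroup.inclusion_injective hf)
  refine ⟨f.ker, ?_, Subgroup.finiteIndex_ker f⟩
  have hk : ∀ x ∈ f.ker, (x : G) ∈ commutator G := by
    intro x hx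
    rw [← Abelianization.ker_of]
    exact hx
  intro x hx y hy
  exact Subtype.ext (hmet _ (hk x hx) _ (hk y hy))

lemma assemble {G : Type*} [Group G]
    (hmet : ∀ x ∈ commutator G, ∀ y ∈ commutator G, x * y = y * x)
    {m k : ℕ} (s : Fin m → G) (hs : ∀ i, IsOfFinOrder (Abelianization.of (s i)))
    (H : Subgroup G) (hH : H.FG) (hiso : Nonempty (H ≃* FreeMetabelian k))
    (hgen : H ⊔ Subgroup.closure (Set.range s) = ⊤) :
    ∃ H K : Subgroup G,
      H.FG ∧ K.FG ∧
      Nonempty (↥H ≃* FreeMetabelian k) ∧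
      (∃ s : Fin m → G, K = Subgroup.closure (Set.range s)) ∧
      VirtuallyAbelian ↥K ∧
      VirtuallyAbelian ↥(Subgroup.normalClosure (K : Set G)) ∧
      H ⊔ K = ⊤ ∧
      (∀ g : G, ∃ l ∈ Subgroup.normalClosure (K : Set G), ∃ h ∈ H, g = l * h) := by
  have hK : Subgroup.closure (Set.range s) ≤ (Subgroup.closure (Set.range fun i =>
      Abelianization.of (s i))).comap Abelianization.of := by
    rw [Subgroup.closure_le]
    rintro _ ⟨i, rfl⟩
    exact Subgroup.subset_closure ⟨i, rfl⟩
  refine ⟨H, Subgroup.closure (Set.range s), hH, ⟨(Set.finite_range s).toFinset, by simp⟩, hiso,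
    ⟨s, rfl⟩, va_of_finite_image hmet s hs _ hK, va_of_finite_image hmet s hs _ ?_, hgen, ?_⟩
  · exact Subgroup.normalClosure_le_normal hK
  · intro g
    have h1 : Subgroup.normalClosure (Subgroup.closure (Set.range s) : Set G) ⊔ H = ⊤ := by
      rw [eq_top_iff, ← hgen, sup_comm]
      exact sup_le_sup_right Subgroup.le_normalClosure _
    have h2 : g ∈ ((Subgroup.normalClosure (Subgroup.closure (Set.range s) : Set G) ⊔ H :
      Subgroup G) : Set G) := by rw [h1]; trivial
    rw [Subgroup.normal_mul] at h2
    obtain ⟨l, hl, h, hh, rfl⟩ := h2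
    exact ⟨l, hl, h, hh, rfl⟩

lemma presented_metabelian {n : ℕ} (R : Set (FreeGroup (Fin n))) :
    ∀ x ∈ commutator (MetabelianPresented R), ∀ y ∈ commutator (MetabelianPresented R),
      x * y = y * x := by
  have hsurj := QuotientGroup.mk'_surjective (metabelianRel R)
  have h2 : derivedSeries (MetabelianPresented R) 2 = ⊥ := by
    rw [eq_bot_iff, ← map_derivedSeries_eq hsurj 2]
    rintro _ ⟨w, hw, rfl⟩
    rw [Subgroup.mem_bot]
    exact (QuotientGroup.eq_one_iff w).2 (Subgroup.subset_normalClosure (Or.inr hw))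
  intro x hx y hy
  rw [← derivedSeries_one] at hx hy
  have := Subgroup.commutator_mem_commutator hx hy
  rw [← derivedSeries_succ, h2, Subgroup.mem_bot] at this
  exact commutatorElement_eq_one_iff_mul_comm.1 this

end VA

section Cases

lemma relMatrix_eq {n m : ℕ} (R : Fin m → FreeGroup (Fin n)) :
    relMatrix R = Matrix.of fun i j => xs j (R i) := rfl

lemma case_le {n m : ℕ} (R : Fin m → FreeGroup (Fin n)) (hnm : n ≤ m)
    (hfull : (relMatrix R).rank = n) :
    ∃ H K : Subgroup (MetabelianPresented (Set.range R)),
      H.FG ∧ K.FG ∧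
      Nonempty (↥H ≃* FreeMetabelian (n - m)) ∧
      (∃ s : Fin m → MetabelianPresented (Set.range R), K = Subgroup.closure (Set.range s)) ∧
      VirtuallyAbelian ↥K ∧
      VirtuallyAbelian ↥(Subgroup.normalClosure (K : Set (MetabelianPresented (Set.range R)))) ∧
      H ⊔ K = ⊤ ∧
      (∀ g : MetabelianPresented (Set.range R),
        ∃ l ∈ Subgroup.normalClosure (K : Set (MetabelianPresented (Set.range R))),
          ∃ h ∈ H, g = l * h) := by
  let q := QuotientGroup.mk' (metabelianRel (Set.range R))
  have hq : ∀ i, q (R i) = 1 := fun i =>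
    (QuotientGroup.eq_one_iff _).2 (Subgroup.subset_normalClosure (Or.inl ⟨i, rfl⟩))
  let s : Fin m → MetabelianPresented (Set.range R) := fun i =>
    if h : i.val < n then q (FreeGroup.of ⟨i.val, h⟩) else 1
  rw [Nat.sub_eq_zero_of_le hnm]
  refine assemble (presented_metabelian _) s ?_ ⊥ ⟨∅, by simp⟩ ?_ ?_
  · intro i
    by_cases hi : i.val < n
    · simp only [s, hi, dif_pos]
      refine torsion_of_left_inv (id : Fin n → Fin n) Function.injective_id q R hq ?_ ?_ ⟨i, hi⟩
      · intro i x hx; simp at hx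
      · rw [Fintype.card_fin]; exact hfull
    · simp only [s, hi, dif_neg, not_false_eq_true, map_one]
      exact IsOfFinOrder.one
  · have : Subsingleton (FreeMetabelian 0) :=
      Function.Surjective.subsingleton (QuotientGroup.mk_surjective)
    have : Unique (FreeMetabelian 0) := ⟨⟨1⟩, fun _ => Subsingleton.elim _ _⟩
    exact ⟨MulEquiv.ofUnique⟩
  · rw [bot_sup_eq, eq_top_iff]
    have h1 : (⊤ : Subgroup (MetabelianPresented (Set.range R))) =
        (⊤ : Subgroup (FreeGroup (Fin n))).map q := by
      rw [← MonoidHom.range_eq_map, MonoidHom.range_eq_top.2 (QuotientGroup.mk'_surjective _)]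
    rw [h1, ← FreeGroup.closure_range_of, MonoidHom.map_closure, Subgroup.closure_le]
    rintro _ ⟨_, ⟨j, rfl⟩, rfl⟩
    apply Subgroup.subset_closure
    refine ⟨⟨j.val, by omega⟩, ?_⟩
    simp [s]

lemma case_ge {n m : ℕ} (R : Fin m → FreeGroup (Fin n)) (hnm : m ≤ n)
    (hfull : (relMatrix R).rank = m) :
    ∃ H K : Subgroup (MetabelianPresented (Set.range R)),
      H.FG ∧ K.FG ∧
      Nonempty (↥H ≃* FreeMetabelian (n - m)) ∧
      (∃ s : Fin m → MetabelianPresented (Set.range R), K = Subgroup.closure (Set.range s)) ∧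
      VirtuallyAbelian ↥K ∧
      VirtuallyAbelian ↥(Subgroup.normalClosure (K : Set (MetabelianPresented (Set.range R)))) ∧
      H ⊔ K = ⊤ ∧
      (∀ g : MetabelianPresented (Set.range R),
        ∃ l ∈ Subgroup.normalClosure (K : Set (MetabelianPresented (Set.range R))),
          ∃ h ∈ H, g = l * h) := by
  obtain ⟨θ, hθ⟩ := nielsen R
  let e : Fin m ⊕ Fin (n - m) ≃ Fin n :=
    finSumFinEquiv.trans (finCongr (Nat.add_sub_of_le hnm))
  let E : FreeGroup (Fin m ⊕ Fin (n - m)) ≃* FreeGroup (Fin n) :=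
    (FreeGroup.freeGroupCongr e).trans θ.symm
  let R' : Fin m → FreeGroup (Fin m ⊕ Fin (n - m)) := fun i => E.symm (R i)
  let q : FreeGroup (Fin m ⊕ Fin (n - m)) →* MetabelianPresented (Set.range R) :=
    (QuotientGroup.mk' (metabelianRel (Set.range R))).comp E.toMonoidHom
  have hqs : Function.Surjective q :=
    (QuotientGroup.mk'_surjective _).comp E.surjective
  have hq : ∀ i, q (R' i) = 1 := by
    intro i
    have : q (R' i) = QuotientGroup.mk' (metabelianRel (Set.range R)) (R i) := by
      simp [q, R']
    rw [this]
    exact (QuotientGroup.eq_one_iff _).2 (Subgroup.subset_normalClosure (Or.inl ⟨i, rfl⟩))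
  have hxs : ∀ x i, xs x (R' i) = xs (e x) (θ (R i)) := by
    intro x i
    rw [← xs_congr]; rfl
  have hβ : ∀ i b, xs (Sum.inr b) (R' i) = 0 := by
    intro i b
    rw [hxs]
    apply hθ
    have := i.2
    simp [e]
    omega
  let B : Matrix (Fin m) (Fin m) ℤ := Matrix.of fun i j => xs (Sum.inl j) (R' i)
  have hB : B.rank = Fintype.card (Fin m) := by
    apply le_antisymm (Matrix.rank_le_card_width B)
    have hfac : relMatrix R = B * (Matrix.of fun y j => xs j (E (FreeGroup.of (Sum.inl y))) :
        Matrix (Fin m) (Fin n) ℤ) := by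
      ext i j
      have h1 := xs_hom ((xsHom j).comp E.toMonoidHom) (R' i)
      have h2 := congrArg Multiplicative.toAdd h1
      rw [Fintype.prod_sum_type] at h2
      simp only [hβ, zpow_zero, Finset.prod_const_one, mul_one] at h2
      have h3 : Multiplicative.toAdd (((xsHom j).comp E.toMonoidHom) (R' i)) = xs j (R i) := by
        simp [R', xs]
      rw [h3, toAdd_prod] at h2
      rw [relMatrix_eq, Matrix.of_apply, h2, Matrix.mul_apply]
      rfl
    have hle : (relMatrix R).rank ≤ B.rank := by
      rw [hfac]; exact Matrix.rank_mul_le_left _ _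
    rw [Fintype.card_fin]
    omega
  have hdet := det_ne_zero_of_rank B hB
  let φ : FreeGroup (Fin (n - m)) →* MetabelianPresented (Set.range R) :=
    q.comp (FreeGroup.map Sum.inr)
  have hker : φ.ker = derivedSeries (FreeGroup (Fin (n - m))) 2 := by
    apply le_antisymm
    · intro w hw
      apply freeness R' hβ hdet w
      have h1 : E (FreeGroup.map Sum.inr w) ∈ metabelianRel (Set.range R) :=
        (QuotientGroup.eq_one_iff _).1 hw
      have h2 : (metabelianRel (Set.range R)).map E.symm.toMonoidHom ≤
          Subgroup.normalClosure (Set.range R' ∪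
            (derivedSeries (FreeGroup (Fin m ⊕ Fin (n - m))) 2 :
              Subgroup (FreeGroup (Fin m ⊕ Fin (n - m))))) := by
        rw [Subgroup.map_le_iff_le_comap]
        apply Subgroup.normalClosure_le_normal
        rintro _ (⟨i, rfl⟩ | hx)
        · exact Subgroup.subset_normalClosure (Or.inl ⟨i, rfl⟩)
        · apply Subgroup.subset_normalClosure
          right
          exact map_derivedSeries_le_derivedSeries E.symm.toMonoidHom 2
            (Subgroup.mem_map_of_mem _ hx)
      have h3 := h2 (Subgroup.mem_map_of_mem _ h1)
      simpa using h3
    · intro w hw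
      apply (QuotientGroup.eq_one_iff _).2
      apply Subgroup.subset_normalClosure
      right
      exact map_derivedSeries_le_derivedSeries (E.toMonoidHom.comp (FreeGroup.map Sum.inr)) 2
            (Subgroup.mem_map_of_mem _ hw)
  have hrange : φ.range = Subgroup.closure (Set.range fun b => q (FreeGroup.of (Sum.inr b))) := by
    rw [MonoidHom.range_eq_map, ← FreeGroup.closure_range_of, MonoidHom.map_closure,
      ← Set.range_comp]
    congr 2
  refine assemble (presented_metabelian _) (fun i => q (FreeGroup.of (Sum.inl i))) ?_ φ.range
    ?_ ?_ ?_
  · refine torsion_of_left_inv Sum.inl Sum.inl_injective q R' hq ?_ hB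
    rintro i (x | x) hx
    · exact absurd ⟨x, rfl⟩ hx
    · exact hβ i x
  · rw [hrange]
    exact ⟨(Set.finite_range fun b => q (FreeGroup.of (Sum.inr b))).toFinset, by simp⟩
  · exact ⟨((QuotientGroup.quotientMulEquivOfEq hker.symm).trans
      (QuotientGroup.quotientKerEquivRange φ)).symm⟩
  · rw [hrange, ← Subgroup.closure_union, eq_top_iff, ← MonoidHom.range_eq_top.2 hqs,
      MonoidHom.range_eq_map, ← FreeGroup.closure_range_of, MonoidHom.map_closure,
      Subgroup.closure_le]
    rintro _ ⟨_, ⟨x | x, rfl⟩, rfl⟩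
    · exact Subgroup.subset_closure (Or.inr ⟨x, rfl⟩)
    · exact Subgroup.subset_closure (Or.inl ⟨x, rfl⟩)

end Cases

/-- A metabelian group given by a full-rank presentation with `n` generators
and `m` relators is a product `G = L·H` with `H` free metabelian of rank `max(n-m,0)` and
`L` the virtually abelian normal closure of an `m`-generated virtually abelian subgroup `K`. -/
theorem full_rank_structure {n m : ℕ} (R : Fin m → FreeGroup (Fin n))
    (hfull : (relMatrix R).rank = min m n) :
    ∃ H K : Subgroup (MetabelianPresented (Set.range R)),
      H.FG ∧ K.FG ∧
      Nonempty (↥H ≃* FreeMetabelian (n - m)) ∧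
      (∃ s : Fin m → MetabelianPresented (Set.range R), K = Subgroup.closure (Set.range s)) ∧
      VirtuallyAbelian ↥K ∧
      VirtuallyAbelian ↥(Subgroup.normalClosure (K : Set (MetabelianPresented (Set.range R)))) ∧
      H ⊔ K = ⊤ ∧
      (∀ g : MetabelianPresented (Set.range R),
        ∃ l ∈ Subgroup.normalClosure (K : Set (MetabelianPresented (Set.range R))),
          ∃ h ∈ H, g = l * h) := by
  rcases le_total n m with h | h
  · exact case_le R h (by rw [hfull, min_eq_right h])
  · exact case_ge R h (by rw [hfull, min_eq_left h])
end

section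
/- Let G be a finitely generated metabelian group given by a full-rank presentation G = ⟨A ∣ R⟩_M with |R| ≤ |A| − 1. Then in any decomposition of G as a direct product G = G_1 × ⋯ × G_k, all but at most one of the factors G_1,…,G_k are virtually abelian. -/
open scoped commutatorElement

theorem fd_exists_hom {n : ℕ} {H : Type*} [Group H] (q : FreeGroup (Fin n) →* H)
    (hs : Function.Surjective q) (hq : derivedSeries (FreeGroup (Fin n)) 2 ≤ q.ker)
    (hH : ¬ VirtuallyAbelian H) : ∃ (f : H →* Multiplicative ℤ) (h : H), f h ≠ 1 := by
  have hfg : Group.FG H := Group.fg_of_surjective hs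
  have hinf : ¬ Finite (Abelianization H) := by
    intro hfin
    apply hH
    refine ⟨commutator H, ?_, ?_⟩
    · have hD : derivedSeries H 2 = ⊥ := by
        rw [← map_derivedSeries_eq hs 2, Subgroup.map_eq_bot_iff]
        exact hq
      have h2 : ⁅commutator H, commutator H⁆ = ⊥ := by
        rw [← hD]
        rw [derivedSeries_succ, derivedSeries_one]
      intro x hx y hy
      have := (Subgroup.commutator_eq_bot_iff_le_centralizer.mp h2) hx
      exact ((Subgroup.mem_centralizer_iff.mp this) y hy).symm
    · have : Finite (H ⧸ commutator H) := hfin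
      exact Subgroup.finiteIndex_of_finite_quotient
  let M := Additive (Abelianization H)
  have hfgA : Group.FG (Abelianization H) :=
    Group.fg_of_surjective (f := Abelianization.of) (QuotientGroup.mk'_surjective _)
  have : AddGroup.FG M := inferInstance
  have : Module.Finite ℤ M := Module.Finite.iff_addGroup_fg.mpr this
  have hnt : ¬ Module.IsTorsion ℤ M := by
    intro ht
    exact hinf (Module.finite_of_fg_torsion M ht)
  have : ∃ x : M, x ∉ Submodule.torsion ℤ M := by
    by_contra! hcon
    apply hnt
    intro x
    exact (Submodule.mem_torsion_iff x).mp (hcon x)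
  obtain ⟨x, hx⟩ := this
  have hx' : (Submodule.Quotient.mk x : M ⧸ Submodule.torsion ℤ M) ≠ 0 := by
    rwa [Ne, Submodule.Quotient.mk_eq_zero]
  have : Module.Free ℤ (M ⧸ Submodule.torsion ℤ M) := inferInstance
  obtain ⟨f, hf⟩ : ∃ f : Module.Dual ℤ (M ⧸ Submodule.torsion ℤ M),
      f (Submodule.Quotient.mk x) ≠ 0 := by
    by_contra! hcon
    exact hx' ((Module.forall_dual_apply_eq_zero_iff ℤ _).mp hcon)
  obtain ⟨h, hh⟩ := QuotientGroup.mk'_surjective (commutator H) (Additive.toMul x)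
  let g : M →+ ℤ := (f ∘ₗ (Submodule.mkQ _)).toAddMonoidHom
  refine ⟨(AddMonoidHom.toMultiplicativeRight g).comp Abelianization.of, h, ?_⟩
  intro h0
  apply hf
  have h1 : g (Additive.ofMul (Abelianization.of h)) = 0 := h0
  have h2 : Abelianization.of h = Additive.toMul x := hh
  rw [h2] at h1
  exact h1

/-- The universal crossed homomorphism (evaluated Fox derivatives). -/
theorem fd_exists_fox {n : ℕ} (χ : FreeGroup (Fin n) →* ℚˣ) :
    ∃ D : FreeGroup (Fin n) → (Fin n → ℚ),
      (∀ j, D (FreeGroup.of j) = Pi.single j 1) ∧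
      ∀ x y, D (x * y) = D x + (χ x : ℚ) • D y := by
  let T : Fin n → Equiv.Perm (Fin n → ℚ) := fun j =>
    (MulAction.toPerm (χ (FreeGroup.of j))).trans (Equiv.addRight (Pi.single j 1))
  let P := FreeGroup.lift T
  have key : ∀ w x, P w x = (χ w : ℚ) • x + P w 0 := by
    intro w
    induction w using FreeGroup.induction_on with
    | C1 => intro x; simp [P]
    | of j => intro x; simp [P, T, Units.smul_def]
    | inv_of j ih =>
      intro x
      rw [map_inv, Equiv.Perm.inv_eq_iff_eq, ih, map_inv]
      have h0 : P (FreeGroup.of j) ((P (FreeGroup.of j))⁻¹ 0) = 0 := by simp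
      rw [ih] at h0
      rw [smul_add, smul_smul, add_assoc, h0]
      simp
    | mul a b iha ihb =>
      intro x
      rw [map_mul, Equiv.Perm.mul_apply, Equiv.Perm.mul_apply, ihb, iha, iha (P b 0), map_mul]
      rw [smul_add, smul_smul, Units.val_mul, add_assoc]
  refine ⟨fun w => P w 0, ?_, ?_⟩
  · intro j; simp [P, T]
  · intro x y
    show P (x * y) 0 = P x 0 + (χ x : ℚ) • P y 0
    rw [map_mul, Equiv.Perm.mul_apply, key, add_comm]

theorem fd_vanish {n m : ℕ} (R : Fin m → FreeGroup (Fin n)) (χ : FreeGroup (Fin n) →* ℚˣ)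
    (hχ : ∀ i, χ (R i) = 1) (d : FreeGroup (Fin n) → ℚ)
    (hd : ∀ x y, d (x * y) = d x + χ x * d y) (hR : ∀ i, d (R i) = 0) :
    ∀ w ∈ metabelianRel (Set.range R), χ w = 1 ∧ d w = 0 := by
  have h1 : d 1 = 0 := by have := hd 1 1; simp at this; exact this
  have hinv : ∀ x, d x + χ x * d x⁻¹ = 0 := by
    intro x; rw [← hd, mul_inv_cancel, h1]
  let S : Subgroup (FreeGroup (Fin n)) :=
    { carrier := {w | χ w = 1 ∧ d w = 0}
      one_mem' := ⟨map_one _, h1⟩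
      mul_mem' := by
        rintro a b ⟨ha, ha'⟩ ⟨hb, hb'⟩
        exact ⟨by rw [map_mul, ha, hb, one_mul], by rw [hd, ha', hb']; simp⟩
      inv_mem' := by
        rintro a ⟨ha, ha'⟩
        refine ⟨by rw [map_inv, ha, inv_one], ?_⟩
        have := hinv a
        rw [ha, ha'] at this
        simpa using this }
  have hS : S.Normal := by
    constructor
    rintro w ⟨hw, hw'⟩ g
    refine ⟨by simp [hw], ?_⟩
    rw [hd, hd, hw', map_mul, hw, mul_one, mul_zero, add_zero, hinv]
  have hle : metabelianRel (Set.range R) ≤ S := by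
    apply Subgroup.normalClosure_le_normal
    rintro w (⟨i, rfl⟩ | hw)
    · exact ⟨hχ i, hR i⟩
    · have hF : ∀ x ∈ derivedSeries (FreeGroup (Fin n)) 1, χ x = 1 := by
        intro x hx
        rw [derivedSeries_one] at hx
        exact Abelianization.commutator_subset_ker χ hx
      have : derivedSeries (FreeGroup (Fin n)) 2 ≤ S := by
        rw [derivedSeries_succ, Subgroup.commutator_le]
        intro a ha b hb
        have hχab : χ ⁅a, b⁆ = 1 := by
          rw [map_commutatorElement, commutatorElement_eq_one_iff_mul_comm, mul_comm]
        refine ⟨hχab, ?_⟩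
        have e1 : d (⁅a, b⁆ * (b * a)) = d (a * b) := by
          congr 1; rw [commutatorElement_def]; group
        rw [hd, hχab, hd, hd, hF a ha, hF b hb] at e1
        simp at e1
        linarith
      exact this hw
  exact hle

theorem fd_def_two {n m : ℕ} (R : Fin m → FreeGroup (Fin n)) (hm : m + 2 ≤ n)
    (χ : FreeGroup (Fin n) →* ℚˣ) (hχ : ∀ i, χ (R i) = 1)
    (A B : FreeGroup (Fin n)) (hA : χ A ≠ 1) (hB : χ B ≠ 1)
    (hAB : ⁅A, B⁆ ∈ metabelianRel (Set.range R))
    (hdec : ∀ w, ∃ x y, w = x * y ∧ ⁅x, B⁆ ∈ metabelianRel (Set.range R) ∧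
      ⁅A, y⁆ ∈ metabelianRel (Set.range R)) : False := by
  obtain ⟨D, hD1, hD⟩ := fd_exists_fox χ
  -- solutions that in addition vanish on A
  let L : (Fin n → ℚ) →ₗ[ℚ] (Option (Fin m) → ℚ) :=
    Matrix.mulVecLin (Matrix.of fun o => o.elim (D A) (fun i => D (R i)))
  have hker : L.ker ≠ ⊥ := by
    intro h
    have := LinearMap.finrank_le_finrank_of_injective (LinearMap.ker_eq_bot.mp h)
    simp at this
    omega
  obtain ⟨v, hv, hv0⟩ := Submodule.exists_mem_ne_zero_of_ne_bot hker
  rw [LinearMap.mem_ker] at hv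
  let d : FreeGroup (Fin n) → ℚ := fun w => D w ⬝ᵥ v
  have hd : ∀ x y, d (x * y) = d x + χ x * d y := by
    intro x y; simp [d, hD, add_dotProduct, smul_dotProduct]
  have hdA : d A = 0 := congrFun hv none
  have hdR : ∀ i, d (R i) = 0 := fun i => congrFun hv (some i)
  have hvan := fd_vanish R χ hχ d hd hdR
  have comm : ∀ a b, ⁅a, b⁆ ∈ metabelianRel (Set.range R) → d (a * b) = d (b * a) := by
    intro a b hab
    obtain ⟨h1, h2⟩ := hvan _ hab
    have e1 : d (⁅a, b⁆ * (b * a)) = d (a * b) := by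
      congr 1; rw [commutatorElement_def]; group
    rw [← e1, hd, h1, h2]; simp
  have cA : ∀ y, ⁅A, y⁆ ∈ metabelianRel (Set.range R) → d y = 0 := by
    intro y hy
    have := comm _ _ hy
    rw [hd, hd, hdA] at this
    have h3 : ((χ A : ℚ) - 1) * d y = 0 := by linarith
    rcases mul_eq_zero.mp h3 with h | h
    · exact absurd (Units.ext (by simpa using sub_eq_zero.mp h)) hA
    · exact h
  have hdB := cA B hAB
  have cB : ∀ y, ⁅y, B⁆ ∈ metabelianRel (Set.range R) → d y = 0 := by
    intro y hy
    have := comm _ _ hy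
    rw [hd, hd, hdB] at this
    have h3 : ((χ B : ℚ) - 1) * d y = 0 := by linarith
    rcases mul_eq_zero.mp h3 with h | h
    · exact absurd (Units.ext (by simpa using sub_eq_zero.mp h)) hB
    · exact h
  apply hv0
  funext j
  obtain ⟨x, y, hw, hx, hy⟩ := hdec (FreeGroup.of j)
  have : d (FreeGroup.of j) = 0 := by rw [hw, hd, cB x hx, cA y hy]; simp
  simpa [d, hD1] using this

theorem fd_hom_eq_sum {n : ℕ} (f : FreeGroup (Fin n) →* Multiplicative ℤ)
    (w : FreeGroup (Fin n)) :
    (f w).toAdd = ∑ j, expSum j w * (f (FreeGroup.of j)).toAdd := by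
  induction w using FreeGroup.induction_on with
  | C1 => simp [expSum]
  | of i => simp [expSum]
  | inv_of i ih => simp [expSum]
  | mul a b iha ihb =>
    have : ∀ j, expSum j (a * b) = expSum j a + expSum j b := by intro j; simp [expSum]
    rw [map_mul, toAdd_mul, iha, ihb, ← Finset.sum_add_distrib]
    simp only [this, add_mul]

theorem fd_def_one {n m : ℕ} (R : Fin m → FreeGroup (Fin n))
    (hr : (relMatrix R).rank + 1 = n)
    (f g : FreeGroup (Fin n) →* Multiplicative ℤ) (hf : ∀ i, f (R i) = 1)
    (hg : ∀ i, g (R i) = 1) (A B : FreeGroup (Fin n)) (hfA : f A ≠ 1) (hgA : g A = 1)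
    (hfB : f B = 1) (hgB : g B ≠ 1) : False := by
  let vec : (FreeGroup (Fin n) →* Multiplicative ℤ) → Fin n → ℤ :=
    fun f j => (f (FreeGroup.of j)).toAdd
  have hvec : ∀ f : FreeGroup (Fin n) →* Multiplicative ℤ, (∀ i, f (R i) = 1) →
      vec f ∈ (relMatrix R).mulVecLin.ker := by
    intro f hf
    rw [LinearMap.mem_ker]
    funext i
    have := fd_hom_eq_sum f (R i)
    rw [hf i] at this
    exact this.symm
  have hk : Module.finrank ℤ (relMatrix R).mulVecLin.ker = 1 := by
    have := Submodule.finrank_quotient_add_finrank (relMatrix R).mulVecLin.ker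
    rw [(relMatrix R).mulVecLin.quotKerEquivRange.finrank_eq] at this
    rw [Module.finrank_fin_fun] at this
    unfold Matrix.rank at hr
    omega
  let u : Fin 2 → (relMatrix R).mulVecLin.ker := ![⟨vec f, hvec f hf⟩, ⟨vec g, hvec g hg⟩]
  have hli : LinearIndependent ℤ u := by
    rw [LinearIndependent.pair_iff]
    intro s t hst
    have hst' : s • vec f + t • vec g = 0 := congrArg Subtype.val hst
    have ev : ∀ w, s * (f w).toAdd + t * (g w).toAdd = 0 := by
      intro w
      rw [fd_hom_eq_sum f, fd_hom_eq_sum g, Finset.mul_sum, Finset.mul_sum,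
        ← Finset.sum_add_distrib]
      apply Finset.sum_eq_zero
      intro j _
      have := congrFun hst' j
      simp [vec] at this
      linear_combination expSum j w * this
    constructor
    · have := ev A
      rw [hgA] at this
      simpa [hfA] using this
    · have := ev B
      rw [hfB] at this
      simpa [hgB] using this
  have := hli.fintype_card_le_finrank
  rw [hk] at this
  simp at this

/-- If a metabelian group is given by a full-rank presentation with
`|R| ≤ |A| - 1`, then in any direct decomposition all but at most one factor is
virtually abelian. -/
theorem full_rank_direct_decomposition {n m : ℕ} (R : Fin m → FreeGroup (Fin n))
    (hfull : (relMatrix R).rank = min m n) (hm : m + 1 ≤ n)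
    (k : ℕ) (Gi : Fin k → Type*) [∀ i, Group (Gi i)]
    (e : MetabelianPresented (Set.range R) ≃* (∀ i, Gi i)) :
    ∀ i j : Fin k, i ≠ j → VirtuallyAbelian (Gi i) ∨ VirtuallyAbelian (Gi j) := by
  intro i j hij
  by_contra! hcon
  obtain ⟨hi, hj⟩ := hcon
  let p : FreeGroup (Fin n) →* (∀ i, Gi i) :=
    e.toMonoidHom.comp (QuotientGroup.mk' (metabelianRel (Set.range R)))
  have hp : Function.Surjective p :=
    e.surjective.comp (QuotientGroup.mk'_surjective _)
  have hpk : ∀ w, p w = 1 ↔ w ∈ metabelianRel (Set.range R) := by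
    intro w
    show e (QuotientGroup.mk' _ w) = 1 ↔ _
    rw [EmbeddingLike.map_eq_one_iff]
    exact QuotientGroup.eq_one_iff w
  have hR : ∀ l, p (R l) = 1 := fun l =>
    (hpk _).mpr (Subgroup.subset_normalClosure (Or.inl ⟨l, rfl⟩))
  have hF : ∀ w ∈ derivedSeries (FreeGroup (Fin n)) 2, p w = 1 := fun w hw =>
    (hpk _).mpr (Subgroup.subset_normalClosure (Or.inr hw))
  have hom : ∀ l, ¬ VirtuallyAbelian (Gi l) →
      ∃ (f : Gi l →* Multiplicative ℤ) (h : Gi l), f h ≠ 1 := by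
    intro l hl
    refine fd_exists_hom ((Pi.evalMonoidHom Gi l).comp p)
      ((Function.surjective_eval l).comp hp) ?_ hl
    intro w hw
    rw [MonoidHom.mem_ker, MonoidHom.comp_apply, hF w hw, map_one]
  obtain ⟨f, a, ha⟩ := hom i hi
  obtain ⟨g, b, hb⟩ := hom j hj
  obtain ⟨A, hA⟩ := hp (Pi.mulSingle i a)
  obtain ⟨B, hB⟩ := hp (Pi.mulSingle j b)
  let f' := (f.comp (Pi.evalMonoidHom Gi i)).comp p
  let g' := (g.comp (Pi.evalMonoidHom Gi j)).comp p
  have hf'R : ∀ l, f' (R l) = 1 := fun l => by simp [f', hR]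
  have hg'R : ∀ l, g' (R l) = 1 := fun l => by simp [g', hR]
  have hfA : f' A = f a := by simp [f', hA]
  have hgA : g' A = 1 := by simp [g', hA, Pi.mulSingle_eq_of_ne hij.symm]
  have hfB : f' B = 1 := by simp [f', hB, Pi.mulSingle_eq_of_ne hij]
  have hgB : g' B = g b := by simp [g', hB]
  rcases Nat.lt_or_ge n (m + 2) with hlt | hge
  · refine fd_def_one R ?_ f' g' hf'R hg'R A B (hfA ▸ ha) hgA hfB (hgB ▸ hb)
    rw [hfull]
    omega
  · let χ : FreeGroup (Fin n) →* ℚˣ := (zpowersHom ℚˣ (Units.mk0 2 two_ne_zero)).comp (f' * g')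
    have hχ : ∀ w, χ w = 1 ↔ f' w * g' w = 1 := by
      intro w
      show (Units.mk0 (2 : ℚ) two_ne_zero) ^ (f' w * g' w).toAdd = 1 ↔ _
      rw [← Units.val_inj]
      simp only [Units.val_zpow_eq_zpow_val, Units.val_mk0, Units.val_one]
      rw [zpow_eq_one_iff_right₀ (by norm_num) (by norm_num)]
      exact toAdd_eq_zero
    have hcomm : ∀ x y, Commute (p x) (p y) → ⁅x, y⁆ ∈ metabelianRel (Set.range R) := by
      intro x y hxy
      rw [← hpk, map_commutatorElement]
      exact commutatorElement_eq_one_iff_commute.mpr hxy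
    refine fd_def_two R hge χ (fun l => ?_) A B ?_ ?_ (hcomm _ _ ?_) ?_
    · rw [hχ, hf'R, hg'R, one_mul]
    · rw [Ne, hχ, hfA, hgA, mul_one]; exact ha
    · rw [Ne, hχ, hfB, hgB, one_mul]; exact hb
    · rw [hA, hB]; exact Pi.mulSingle_commute hij a b
    · intro w
      obtain ⟨x, hx⟩ := hp (Pi.mulSingle i (p w i))
      refine ⟨x, x⁻¹ * w, by group, hcomm _ _ ?_, hcomm _ _ ?_⟩
      · rw [hx, hB]; exact Pi.mulSingle_commute hij _ b
      · rw [hA, map_mul, map_inv, hx]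
        show _ * _ = _ * _
        funext l
        rcases eq_or_ne l i with rfl | hl
        · simp
        · simp [Pi.mulSingle_eq_of_ne hl]
end

section
/- Fix n, m ≥ 1. For each ℓ ≥ 1, let R = {r_1,…,r_m} be a set of m words of length ℓ over the alphabet A^{±1} = {a_1^{±1},…,a_n^{±1}}, where each word is obtained by successively concatenating ℓ letters chosen independently and uniformly at random from the 2n letters of A^{±1}, and the m words are chosen independently. Then the probability that the m×n integer relation matrix M(A,R) has rank min(n,m) tends to 1 as ℓ → ∞. -/
/-- The relation matrix of an `m`-tuple of words of length `ℓ` over the alphabet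
`A^{±1}` (a letter is a generator index in `Fin n` together with a sign, `true` meaning the
generator itself and `false` its inverse): the `(i,j)` entry is the exponent sum of the `j`-th
generator in the `i`-th word. -/
def letterMatrix {n m ℓ : ℕ} (w : Fin m → Fin ℓ → Fin n × Bool) : Matrix (Fin m) (Fin n) ℤ :=
  fun i j => ∑ t : Fin ℓ, if (w i t).1 = j then (if (w i t).2 then 1 else -1) else 0

theorem rrm_map_sum {G ι : Type} [AddCommGroup G] [Fintype ι] (ψ : AddChar G ℂ) (f : ι → G) :
    ψ (∑ i, f i) = ∏ i, ψ (f i) := by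
  classical
  have : ∀ S : Finset ι, ψ (∑ i ∈ S, f i) = ∏ i ∈ S, ψ (f i) := by
    intro S
    induction S using Finset.induction_on with
    | empty => simp
    | insert a S ha ih =>
      rw [Finset.sum_insert ha, Finset.prod_insert ha, AddChar.map_add_eq_mul, ih]
  exact this _

theorem rrm_equidist {G L : Type} [AddCommGroup G] [Fintype G] [DecidableEq G] [Fintype L]
    [DecidableEq L] [Nonempty L]
    (s : L → G) (h : ∀ ψ : AddChar G ℂ, ψ ≠ 0 → ‖∑ l, ψ (s l)‖ < Fintype.card L) (x : G) :
    Filter.Tendsto (fun ℓ : ℕ =>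
      ((Finset.univ.filter (fun w : Fin ℓ → L => ∑ t, s (w t) = x)).card : ℝ) /
        (Fintype.card L : ℝ) ^ ℓ) Filter.atTop (nhds (1 / (Fintype.card G : ℝ))) := by
  classical
  have hG : (Fintype.card G : ℂ) ≠ 0 := Nat.cast_ne_zero.2 Fintype.card_ne_zero
  have hL : (Fintype.card L : ℂ) ≠ 0 := Nat.cast_ne_zero.2 Fintype.card_ne_zero
  have hL0 : (0:ℝ) < (Fintype.card L : ℝ) := Nat.cast_pos.2 Fintype.card_pos
  have key : ∀ ℓ : ℕ, (((Finset.univ.filter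
      (fun w : Fin ℓ → L => ∑ t, s (w t) = x)).card : ℂ) / (Fintype.card L : ℂ) ^ ℓ) =
      ∑ ψ : AddChar G ℂ, ψ (-x) / (Fintype.card G : ℂ) *
        ((∑ l, ψ (s l)) / (Fintype.card L : ℂ)) ^ ℓ := by
    intro ℓ
    have h1 : ∀ w : Fin ℓ → L, (if ∑ t, s (w t) = x then (1:ℂ) else 0) =
        ∑ ψ : AddChar G ℂ, ψ (-x) / (Fintype.card G : ℂ) * ∏ t, ψ (s (w t)) := by
      intro w
      have h2 := AddChar.sum_apply_eq_ite (∑ t, s (w t) - x)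
      have h3 : ∀ ψ : AddChar G ℂ, ψ (∑ t, s (w t) - x) = ψ (-x) * ∏ t, ψ (s (w t)) := by
        intro ψ
        rw [sub_eq_add_neg, AddChar.map_add_eq_mul, rrm_map_sum, mul_comm]
      simp only [h3, sub_eq_zero] at h2
      have h4 : ∑ ψ : AddChar G ℂ, ψ (-x) / (Fintype.card G : ℂ) * ∏ t, ψ (s (w t)) =
          (∑ ψ : AddChar G ℂ, ψ (-x) * ∏ t, ψ (s (w t))) / (Fintype.card G : ℂ) := by
        rw [Finset.sum_div]
        exact Finset.sum_congr rfl fun ψ _ => by ring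
      rw [h4, h2]
      split_ifs <;> simp [hG]
    have h5 : ((Finset.univ.filter (fun w : Fin ℓ → L => ∑ t, s (w t) = x)).card : ℂ) =
        ∑ w : Fin ℓ → L, (if ∑ t, s (w t) = x then (1:ℂ) else 0) := by
      simp
    rw [h5, Finset.sum_congr rfl (fun w _ => h1 w), Finset.sum_comm, Finset.sum_div]
    refine Finset.sum_congr rfl fun ψ _ => ?_
    rw [← Finset.mul_sum, div_pow, mul_div_assoc]
    congr 2
    have := Finset.prod_univ_sum (fun _ : Fin ℓ => (Finset.univ : Finset L))
      (fun _ l => ψ (s l))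
    simpa using this.symm
  have lim : Filter.Tendsto (fun ℓ : ℕ => ∑ ψ : AddChar G ℂ, ψ (-x) / (Fintype.card G : ℂ) *
        ((∑ l, ψ (s l)) / (Fintype.card L : ℂ)) ^ ℓ) Filter.atTop
        (nhds (∑ ψ : AddChar G ℂ, if ψ = 0 then 1 / (Fintype.card G : ℂ) else 0)) := by
    refine tendsto_finsetSum _ fun ψ _ => ?_
    split_ifs with hψ
    · subst hψ
      simp [hL]
    · have : ‖(∑ l, ψ (s l)) / (Fintype.card L : ℂ)‖ < 1 := by
        rw [norm_div, Complex.norm_natCast, div_lt_one hL0]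
        exact h ψ hψ
      simpa using (tendsto_pow_atTop_nhds_zero_of_norm_lt_one this).const_mul
        (ψ (-x) / (Fintype.card G : ℂ))
  simp only [← key, Finset.sum_ite_eq', Finset.mem_univ, if_true] at lim
  have := (Complex.continuous_re.tendsto _).comp lim
  convert this using 2
  · rename_i ℓ
    rw [Function.comp, ← Complex.ofReal_re (_ / _)]
    congr 1
    push_cast
    rfl
  · rw [← Complex.ofReal_re (_ / _)]
    congr 1
    push_cast
    rfl

/-- letter step -/
def rrmStep {n : ℕ} (p : ℕ) (l : Fin n × Bool) : Fin n → ZMod p :=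
  Pi.single l.1 (if l.2 then 1 else -1)

theorem rrm_char {n : ℕ} (hn : 1 ≤ n) (p : ℕ) [Fact p.Prime] (hp : p ≠ 2)
    (ψ : AddChar (Fin n → ZMod p) ℂ) (hψ : ψ ≠ 0) :
    ‖∑ l : Fin n × Bool, ψ (rrmStep p l)‖ < Fintype.card (Fin n × Bool) := by
  obtain ⟨j, hj⟩ : ∃ j : Fin n, ψ (Pi.single j 1) ≠ 1 := by
    by_contra! hcon
    apply hψ
    ext x
    have hx : x = ∑ j, (x j).val • (Pi.single j (1 : ZMod p) : Fin n → ZMod p) := by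
      ext k
      rw [Finset.sum_apply, Finset.sum_eq_single k]
      · rw [Pi.smul_apply, Pi.single_eq_same, nsmul_eq_mul, mul_one, ZMod.natCast_zmod_val]
      · intro b _ hb
        rw [Pi.smul_apply, Pi.single_eq_of_ne hb.symm, smul_zero]
      · simp
    rw [hx, rrm_map_sum]
    simp only [AddChar.map_nsmul_eq_pow, hcon, one_pow, Finset.prod_const_one]
    simp
  have hne : ψ (Pi.single j 1) ≠ ψ (Pi.single j (-1)) := by
    intro heq
    have hpp : ψ (Pi.single j 1) ^ p = 1 := by
      rw [← AddChar.map_nsmul_eq_pow]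
      have : p • (Pi.single j (1 : ZMod p) : Fin n → ZMod p) = 0 := by
        ext k; simp
      rw [this, AddChar.map_zero_eq_one]
    have h2 : ψ (Pi.single j 1) ^ 2 = 1 := by
      nth_rw 1 [pow_two]
      nth_rw 2 [heq]
      rw [← AddChar.map_add_eq_mul, ← Pi.single_add]
      simp
    have hc : Nat.Coprime p 2 :=
      (Nat.coprime_primes (Fact.out : p.Prime) Nat.prime_two).2 hp
    have := pow_gcd_eq_one.2 ⟨hpp, h2⟩
    rw [hc.gcd_eq_one, pow_one] at this
    exact hj this
  have hnorm : ∀ y, ‖ψ y‖ = 1 := fun y => AddChar.norm_apply ψ y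
  have hpair : ‖ψ (Pi.single j 1) + ψ (Pi.single j (-1))‖ < 2 := by
    have hle : ‖ψ (Pi.single j 1) + ψ (Pi.single j (-1))‖ ≤ 2 := by
      refine (norm_add_le _ _).trans ?_
      rw [hnorm, hnorm]; norm_num
    refine lt_of_le_of_ne hle fun h => hne ?_
    apply eq_of_norm_eq_of_norm_add_eq
    · rw [hnorm, hnorm]
    · rw [h, hnorm, hnorm]; norm_num
  rw [Fintype.sum_prod_type]
  have hs : ∀ k : Fin n, ∑ b : Bool, ψ (rrmStep p (k, b)) =
      ψ (Pi.single k 1) + ψ (Pi.single k (-1)) := by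
    intro k; simp [rrmStep]
  simp only [hs]
  calc _ ≤ ∑ k : Fin n, ‖ψ (Pi.single k 1) + ψ (Pi.single k (-1))‖ := norm_sum_le _ _
    _ < ∑ k : Fin n, (2 : ℝ) := by
        refine Finset.sum_lt_sum (fun k _ => ?_) ⟨j, Finset.mem_univ _, hpair⟩
        refine (norm_add_le _ _).trans ?_
        rw [hnorm, hnorm]; norm_num
    _ = _ := by simp

theorem rrm_rank_map_le {m n p : ℕ} [Fact p.Prime] (M : Matrix (Fin m) (Fin n) ℤ) :
    (M.map (Int.cast : ℤ → ZMod p)).rank ≤ M.rank := by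
  rw [Matrix.rank_eq_finrank_span_cols, Matrix.rank_eq_finrank_span_cols]
  set S := Submodule.span ℤ (Set.range M.col) with hS
  let b := Module.finBasis ℤ S
  let c : Fin (Module.finrank ℤ S) → (Fin m → ZMod p) := fun i k => (((b i : Fin m → ℤ) k : ℤ) : ZMod p)
  have hle : Submodule.span (ZMod p) (Set.range (M.map (Int.cast : ℤ → ZMod p)).col) ≤
      Submodule.span (ZMod p) (Set.range c) := by
    rw [Submodule.span_le]
    rintro _ ⟨j, rfl⟩
    have hj : M.col j ∈ S := Submodule.subset_span ⟨j, rfl⟩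
    have h1 := congrArg (fun x : S => (x : Fin m → ℤ)) (b.sum_repr ⟨M.col j, hj⟩)
    have h2 : (M.map (Int.cast : ℤ → ZMod p)).col j =
        ∑ i, ((b.repr ⟨M.col j, hj⟩ i : ℤ) : ZMod p) • c i := by
      ext k
      have h3 := congrFun h1 k
      simp only [AddSubmonoidClass.coe_finsetSum, Finset.sum_apply, Submodule.coe_smul, Pi.smul_apply, smul_eq_mul] at h3
      have h4 := congrArg (Int.cast : ℤ → ZMod p) h3
      push_cast at h4
      simp only [Finset.sum_apply, Pi.smul_apply, smul_eq_mul, c]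
      rw [h4]; rfl
    rw [h2]
    exact Submodule.sum_mem _ fun i _ =>
      Submodule.smul_mem _ _ (Submodule.subset_span ⟨i, rfl⟩)
  refine (Submodule.finrank_mono hle).trans ?_
  simpa [Set.finrank] using finrank_range_le_card (R := ZMod p) c

theorem rrm_count (p : ℕ) [Fact p.Prime] {k N : ℕ} (hk : k ≤ N) :
    (1 - 1 / (p:ℝ)) ^ k ≤
      (Nat.card {s : Fin k → Fin N → ZMod p // LinearIndependent (ZMod p) s} : ℝ) /
        (p : ℝ) ^ (k * N) := by
  have hp0 : (0:ℝ) < p := Nat.cast_pos.2 (Fact.out : p.Prime).pos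
  have hp1 : (1:ℝ) ≤ p := Nat.one_le_cast.2 (Fact.out : p.Prime).pos
  rw [card_linearIndependent (by simpa using hk)]
  simp only [Module.finrank_fin_fun, ZMod.card]
  have hle : ∀ i : Fin k, p ^ (i : ℕ) ≤ p ^ N := fun i =>
    Nat.pow_le_pow_right (Fact.out : p.Prime).pos (by omega)
  push_cast [Nat.cast_sub (hle _)]
  rw [mul_comm k N, pow_mul, ← Fin.prod_const k ((p:ℝ)^N), ← Finset.prod_div_distrib,
    ← Fin.prod_const k (1 - 1 / (p:ℝ))]
  refine Finset.prod_le_prod (fun i _ => ?_) (fun i _ => ?_)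
  · rw [sub_nonneg, div_le_one hp0]; exact hp1
  · rw [sub_div]
    rw [div_self (by positivity)]
    refine sub_le_sub_left ?_ _
    rw [div_le_div_iff₀ (by positivity) hp0, ← pow_succ, one_mul]
    exact pow_le_pow_right₀ hp1 (by omega)

theorem rrm_good (m n p : ℕ) [Fact p.Prime] :
    ∃ B : Finset (Matrix (Fin m) (Fin n) (ZMod p)), (∀ X ∈ B, min m n ≤ X.rank) ∧
      (1 - 1 / (p:ℝ)) ^ (min m n) ≤ (B.card : ℝ) / (p:ℝ) ^ (m * n) := by
  classical
  rcases le_total m n with h | h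
  · refine ⟨Finset.univ.filter (fun X => LinearIndependent (ZMod p) X.row), ?_, ?_⟩
    · intro X hX
      rw [(Finset.mem_filter.1 hX).2.rank_matrix]
      simp
    · rw [min_eq_left h]
      refine (rrm_count p h).trans (le_of_eq ?_)
      congr 2
      rw [Nat.card_eq_fintype_card, Fintype.card_subtype]
      rfl
  · refine ⟨Finset.univ.filter (fun X => LinearIndependent (ZMod p) X.transpose.row), ?_, ?_⟩
    · intro X hX
      rw [← Matrix.rank_transpose, (Finset.mem_filter.1 hX).2.rank_matrix]
      simp
    · rw [min_eq_right h]
      refine (rrm_count p h).trans (le_of_eq ?_)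
      rw [mul_comm n m]
      congr 2
      rw [Nat.card_eq_fintype_card, Fintype.card_subtype]
      refine Finset.card_bij (fun s _ => (Matrix.of s).transpose) ?_ ?_ ?_
      · intro s hs
        exact Finset.mem_filter.2 ⟨Finset.mem_univ _, (Finset.mem_filter.1 hs).2⟩
      · intro s _ t _ hst
        exact Matrix.of.injective (Matrix.transpose_injective hst)
      · intro X hX
        exact ⟨X.transpose, Finset.mem_filter.2 ⟨Finset.mem_univ _, (Finset.mem_filter.1 hX).2⟩, rfl⟩

theorem rrm_row {n m ℓ : ℕ} (p : ℕ) (w : Fin m → Fin ℓ → Fin n × Bool)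
    (X : Matrix (Fin m) (Fin n) (ZMod p)) :
    (letterMatrix w).map (Int.cast : ℤ → ZMod p) = X ↔
      ∀ i, ∑ t, rrmStep p (w i t) = X i := by
  have : ∀ i, ((letterMatrix w).map (Int.cast : ℤ → ZMod p)) i = ∑ t, rrmStep p (w i t) := by
    intro i
    ext j
    simp only [Matrix.map_apply, letterMatrix, rrmStep, Finset.sum_apply, Int.cast_sum,
      Pi.single_apply]
    refine Finset.sum_congr rfl fun t _ => ?_
    by_cases h : (w i t).1 = j
    · rw [if_pos h, if_pos h.symm]; split_ifs <;> simp
    · rw [if_neg h, if_neg (Ne.symm h)]; simp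
  constructor
  · rintro rfl i; exact (this i).symm
  · intro h
    funext i
    rw [this i, h i]

theorem rrm_matrix {n m : ℕ} (hn : 1 ≤ n) (p : ℕ) [Fact p.Prime] (hp : p ≠ 2)
    (X : Matrix (Fin m) (Fin n) (ZMod p)) :
    Filter.Tendsto (fun ℓ : ℕ =>
      ((Finset.univ.filter (fun w : Fin m → Fin ℓ → Fin n × Bool =>
        (letterMatrix w).map (Int.cast : ℤ → ZMod p) = X)).card : ℝ) /
        (Nat.card (Fin m → Fin ℓ → Fin n × Bool) : ℝ))
      Filter.atTop (nhds (1 / (p:ℝ) ^ (m * n))) := by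
  have : Nonempty (Fin n × Bool) := ⟨(⟨0, hn⟩, true)⟩
  have h1 := tendsto_finsetProd (Finset.univ : Finset (Fin m)) (fun i _ =>
    rrm_equidist (rrmStep (n := n) p) (rrm_char hn p hp) (X i))
  convert h1 using 2 with ℓ
  · rw [Finset.prod_div_distrib]
    congr 1
    · rw [← Nat.cast_prod, ← Fintype.card_piFinset]
      congr 2
      ext w
      simp [rrm_row]
    · simp
  · simp [mul_comm m n, pow_mul]

/-- The relation matrix of `m` independent uniformly random words of length `ℓ`
in `n` generators has full rank `min(n,m)` asymptotically almost surely as `ℓ → ∞`: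
the proportion of tuples of words with full-rank relation matrix tends to `1`. -/
theorem random_relation_matrix_full_rank {n m : ℕ} (hn : 1 ≤ n) (hm : 1 ≤ m) :
    Filter.Tendsto (fun ℓ : ℕ =>
      (Nat.card {w : Fin m → Fin ℓ → Fin n × Bool //
          (letterMatrix w).rank = min m n} : ℝ) /
        (Nat.card (Fin m → Fin ℓ → Fin n × Bool) : ℝ))
      Filter.atTop (nhds 1) := by
  classical
  rw [tendsto_order]
  constructor
  · intro a ha
    have hlim : Filter.Tendsto (fun p : ℕ => (1 - 1 / (p:ℝ)) ^ (min m n)) Filter.atTop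
        (nhds 1) := by
      simpa using ((tendsto_const_nhds (x := (1:ℝ))).sub
        tendsto_one_div_atTop_nhds_zero_nat).pow (min m n)
    obtain ⟨P, hP⟩ := Filter.eventually_atTop.1 (hlim.eventually (lt_mem_nhds ha))
    obtain ⟨p, hpP, hp⟩ := Nat.exists_infinite_primes (max P 3)
    have : Fact p.Prime := ⟨hp⟩
    have hp2 : p ≠ 2 := by have := le_max_right P 3; omega
    have hpa := hP p ((le_max_left _ _).trans hpP)
    obtain ⟨B, hB, hBc⟩ := rrm_good m n p
    have h1 := tendsto_finsetSum B (fun X _ => rrm_matrix hn p hp2 X)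
    have h2 : a < ∑ X ∈ B, 1 / (p:ℝ) ^ (m * n) := by
      rw [Finset.sum_const, nsmul_eq_mul, mul_one_div]
      exact hpa.trans_le hBc
    filter_upwards [h1.eventually (lt_mem_nhds h2)] with ℓ hℓ
    refine hℓ.trans_le ?_
    rw [← Finset.sum_div]
    refine div_le_div_of_nonneg_right ?_ (Nat.cast_nonneg _)
    rw [← Nat.cast_sum, Nat.cast_le, Nat.card_eq_fintype_card, Fintype.card_subtype,
      ← Finset.card_biUnion]
    · refine Finset.card_le_card fun w hw => ?_
      simp only [Finset.mem_biUnion, Finset.mem_filter, Finset.mem_univ, true_and] at hw ⊢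
      obtain ⟨X, hX, rfl⟩ := hw
      refine le_antisymm (le_min ?_ ?_) ((hB _ hX).trans (rrm_rank_map_le _))
      · exact Matrix.rank_le_height _
      · exact Matrix.rank_le_width _
    · intro X _ Y _ hXY
      rw [Function.onFun, Finset.disjoint_left]
      intro w hw hw'
      exact hXY ((Finset.mem_filter.1 hw).2.symm.trans (Finset.mem_filter.1 hw').2)
  · intro a ha
    refine Filter.Eventually.of_forall fun ℓ => lt_of_le_of_lt ?_ ha
    refine div_le_one_of_le₀ ?_ (Nat.cast_nonneg _)
    exact_mod_cast Nat.card_le_card_of_injective _ Subtype.val_injective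
end

section
/- For any finite presentation ⟨A ∣ R⟩ with |A| = n and |R| = m, there exists a finite presentation ⟨A' ∣ R'⟩ with |A'| = n and |R'| = m such that the relation matrix M(A',R') is in Smith normal form, rank M(A,R) = rank M(A',R'), and the metabelian groups ⟨A ∣ R⟩_M and ⟨A' ∣ R'⟩_M are isomorphic. -/
/-- An `m × n` integer matrix is in Smith normal form if, for some `r ≥ 0`, the diagonal
entries `d_i = a_{ii}` with `i < r` are positive, all other entries vanish, and each `d_i`
divides `d_{i+1}`. -/
def IsSmithNormalForm {m n : ℕ} (M : Matrix (Fin m) (Fin n) ℤ) : Prop :=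
  ∃ r : ℕ,
    (∀ (i : Fin m) (j : Fin n), ((i : ℕ) ≠ (j : ℕ) ∨ r ≤ (i : ℕ)) → M i j = 0) ∧
    (∀ (i : Fin m) (j : Fin n), (i : ℕ) = (j : ℕ) → (i : ℕ) < r → 0 < M i j) ∧
    (∀ (i i' : Fin m) (j j' : Fin n), (i : ℕ) = (j : ℕ) → (i' : ℕ) = (j' : ℕ) →
      (i : ℕ) + 1 = (i' : ℕ) → (i' : ℕ) < r → M i j ∣ M i' j')


inductive ElemEq : {m n : ℕ} → Matrix (Fin m) (Fin n) ℤ → Matrix (Fin m) (Fin n) ℤ → Prop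
  | refl {m n : ℕ} (M : Matrix (Fin m) (Fin n) ℤ) : ElemEq M M
  | trans {m n : ℕ} {M M' M'' : Matrix (Fin m) (Fin n) ℤ} :
      ElemEq M M' → ElemEq M' M'' → ElemEq M M''
  | addRow {m n : ℕ} {M M' : Matrix (Fin m) (Fin n) ℤ} (k : Fin m) (c : Fin m → ℤ)
      (hc : c k = 0) (h : ∀ i j, M' i j = M i j + c i * M k j) : ElemEq M M'
  | addCol {m n : ℕ} {M M' : Matrix (Fin m) (Fin n) ℤ} (k : Fin n) (c : Fin n → ℤ)
      (hc : c k = 0) (h : ∀ i j, M' i j = M i j + M i k * c j) : ElemEq M M'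
  | perm {m n : ℕ} {M M' : Matrix (Fin m) (Fin n) ℤ} (σ : Equiv.Perm (Fin m))
      (τ : Equiv.Perm (Fin n)) (h : ∀ i j, M' i j = M (σ i) (τ j)) : ElemEq M M'
  | neg {m n : ℕ} {M M' : Matrix (Fin m) (Fin n) ℤ} (s : Fin m → ℤˣ)
      (h : ∀ i j, M' i j = (s i : ℤ) * M i j) : ElemEq M M'

def blk {m n : ℕ} (d : ℤ) (M : Matrix (Fin m) (Fin n) ℤ) :
    Matrix (Fin (m + 1)) (Fin (n + 1)) ℤ :=
  fun i j => Fin.cases (Fin.cases d (fun _ => 0) j)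
    (fun i' => Fin.cases 0 (fun j' => M i' j') j) i

@[simp] lemma blk_zero_zero {m n : ℕ} (d : ℤ) (M : Matrix (Fin m) (Fin n) ℤ) :
    blk d M 0 0 = d := rfl
@[simp] lemma blk_zero_succ {m n : ℕ} (d : ℤ) (M : Matrix (Fin m) (Fin n) ℤ) (j : Fin n) :
    blk d M 0 j.succ = 0 := rfl
@[simp] lemma blk_succ_zero {m n : ℕ} (d : ℤ) (M : Matrix (Fin m) (Fin n) ℤ) (i : Fin m) :
    blk d M i.succ 0 = 0 := rfl
@[simp] lemma blk_succ_succ {m n : ℕ} (d : ℤ) (M : Matrix (Fin m) (Fin n) ℤ) (i : Fin m)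
    (j : Fin n) : blk d M i.succ j.succ = M i j := rfl

lemma ElemEq.lift {m n : ℕ} (d : ℤ) {M M' : Matrix (Fin m) (Fin n) ℤ} (h : ElemEq M M') :
    ElemEq (blk d M) (blk d M') := by
  induction h with
  | refl M => exact .refl _
  | trans _ _ h1 h2 => exact h1.trans h2
  | addRow k c hc h =>
    refine .addRow k.succ (Fin.cons 0 c) (by simpa using hc) fun i j => ?_
    cases i using Fin.cases <;> cases j using Fin.cases <;> simp [h]
  | addCol k c hc h =>
    refine .addCol k.succ (Fin.cons 0 c) (by simpa using hc) fun i j => ?_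
    cases i using Fin.cases <;> cases j using Fin.cases <;> simp [h]
  | perm σ τ h =>
    refine .perm (Equiv.Perm.decomposeFin.symm (0, σ))
      (Equiv.Perm.decomposeFin.symm (0, τ)) fun i j => ?_
    cases i using Fin.cases <;> cases j using Fin.cases <;> simp [h]
  | neg s h =>
    refine .neg (Fin.cons 1 s) fun i j => ?_
    cases i using Fin.cases <;> cases j using Fin.cases <;> simp [h]

lemma ElemEq.dvd {m n : ℕ} (d : ℤ) {M M' : Matrix (Fin m) (Fin n) ℤ} (h : ElemEq M M')
    (hd : ∀ i j, d ∣ M i j) : ∀ i j, d ∣ M' i j := by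
  induction h with
  | refl M => exact hd
  | trans _ _ h1 h2 => exact h2 (h1 hd)
  | addRow k c hc h =>
    intro i j; rw [h]; exact dvd_add (hd _ _) (dvd_mul_of_dvd_right (hd _ _) _)
  | addCol k c hc h =>
    intro i j; rw [h]; exact dvd_add (hd _ _) (dvd_mul_of_dvd_left (hd _ _) _)
  | perm σ τ h => intro i j; rw [h]; exact hd _ _
  | neg s h => intro i j; rw [h]; exact dvd_mul_of_dvd_right (hd _ _) _

lemma rank_addRow_le {m n : ℕ} {M M' : Matrix (Fin m) (Fin n) ℤ} (k : Fin m) (c : Fin m → ℤ)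
    (h : ∀ i j, M' i j = M i j + c i * M k j) : M'.rank ≤ M.rank := by
  have : M' = (1 + Matrix.of fun i l => if l = k then c i else 0) * M := by
    ext i j
    rw [h, Matrix.add_mul, Matrix.one_mul, Matrix.add_apply]; simp [Matrix.mul_apply]
  rw [this]
  exact Matrix.rank_mul_le_right _ _

lemma rank_addCol_le {m n : ℕ} {M M' : Matrix (Fin m) (Fin n) ℤ} (k : Fin n) (c : Fin n → ℤ)
    (h : ∀ i j, M' i j = M i j + M i k * c j) : M'.rank ≤ M.rank := by
  have : M' = M * (1 + Matrix.of fun l j => if l = k then c j else 0) := by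
    ext i j
    rw [h, Matrix.mul_add, Matrix.mul_one, Matrix.add_apply]; simp [Matrix.mul_apply]
  rw [this]
  exact Matrix.rank_mul_le_left _ _

lemma rank_neg_le {m n : ℕ} {M M' : Matrix (Fin m) (Fin n) ℤ} (s : Fin m → ℤˣ)
    (h : ∀ i j, M' i j = (s i : ℤ) * M i j) : M'.rank ≤ M.rank := by
  have : M' = (Matrix.diagonal fun i => (s i : ℤ)) * M := by
    ext i j
    simp [h]
  rw [this]
  exact Matrix.rank_mul_le_right _ _

lemma ElemEq.rank_eq {m n : ℕ} {M M' : Matrix (Fin m) (Fin n) ℤ} (h : ElemEq M M') :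
    M.rank = M'.rank := by
  induction h with
  | refl M => rfl
  | trans _ _ h1 h2 => exact h1.trans h2
  | addRow k c hc h =>
    refine le_antisymm (rank_addRow_le k (-c) fun i j => ?_) (rank_addRow_le k c h)
    simp [h, hc]
  | addCol k c hc h =>
    refine le_antisymm (rank_addCol_le k (-c) fun i j => ?_) (rank_addCol_le k c h)
    simp [h, hc]
  | @perm M M' σ τ h =>
    have : M' = M.submatrix σ τ := by ext i j; simp [h]
    rw [this, Matrix.rank_submatrix]
  | neg s h =>
    refine le_antisymm (rank_neg_le s fun i j => ?_) (rank_neg_le s h)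
    rw [h, ← mul_assoc]
    rcases Int.units_eq_one_or (s i) with hs | hs <;> simp [hs]

/-- A nonzero matrix can be brought to block form with the corner dividing everything. -/
lemma exists_blk {m n : ℕ} (M : Matrix (Fin (m + 1)) (Fin (n + 1)) ℤ) (hM : M ≠ 0) :
    ∃ (d : ℤ) (N : Matrix (Fin m) (Fin n) ℤ), 0 < d ∧ (∀ i j, d ∣ N i j) ∧
      ElemEq M (blk d N) := by
  classical
  have hex : ∃ k : ℕ, 0 < k ∧ ∃ M', ElemEq M M' ∧ ∃ i j, (M' i j).natAbs = k := by
    have : ∃ i j, M i j ≠ 0 := by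
      by_contra! hcon
      exact hM (by ext i j; exact hcon i j)
    obtain ⟨i, j, hij⟩ := this
    exact ⟨(M i j).natAbs, Int.natAbs_pos.mpr hij, M, .refl _, i, j, rfl⟩
  obtain ⟨hpos, M₁, hE₁, i₁, j₁, hij⟩ := Nat.find_spec hex
  have hmin : ∀ M', ElemEq M M' → ∀ i j, M' i j ≠ 0 → Nat.find hex ≤ (M' i j).natAbs :=
    fun M' hE i j h => Nat.find_min' hex ⟨Int.natAbs_pos.mpr h, M', hE, i, j, rfl⟩
  generalize Nat.find hex = d at *
  -- the remainder principle
  have hrem : ∀ M', ElemEq M M' → M' 0 0 = d → ∀ j, (d : ℤ) ∣ M' 0 j := by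
    intro M' hE h0 j
    by_cases hj : j = 0
    · subst hj; rw [h0]
    by_contra hnd
    have hE2 : ElemEq M (Matrix.of fun i l => M' i l +
        M' i 0 * (if l = j then -(M' 0 j / d) else 0)) :=
      hE.trans (.addCol 0 (fun l => if l = j then -(M' 0 j / d) else 0)
        (by simp [Ne.symm hj]) fun i l => rfl)
    have hd0 : (d : ℤ) ≠ 0 := by omega
    have hval : M' 0 j + M' 0 0 * -(M' 0 j / d) = M' 0 j % d := by
      rw [h0, Int.emod_def]; ring
    have h1 := hmin _ hE2 0 j
    simp only [Matrix.of_apply, if_true, hval] at h1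
    have h2 := h1 (fun h => hnd (Int.dvd_of_emod_eq_zero h))
    have h3 := Int.emod_nonneg (M' 0 j) hd0
    have h4 := Int.emod_lt_of_pos (M' 0 j) (show (0:ℤ) < d by omega)
    omega
  have hremc : ∀ M', ElemEq M M' → M' 0 0 = d → ∀ i, (d : ℤ) ∣ M' i 0 := by
    intro M' hE h0 j
    by_cases hj : j = 0
    · subst hj; rw [h0]
    by_contra hnd
    have hE2 : ElemEq M (Matrix.of fun l i => M' l i +
        (if l = j then -(M' j 0 / d) else 0) * M' 0 i) :=
      hE.trans (.addRow 0 (fun l => if l = j then -(M' j 0 / d) else 0)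
        (by simp [Ne.symm hj]) fun i l => rfl)
    have hd0 : (d : ℤ) ≠ 0 := by omega
    have hval : M' j 0 + -(M' j 0 / d) * M' 0 0 = M' j 0 % d := by
      rw [h0, Int.emod_def]; ring
    have h1 := hmin _ hE2 j 0
    simp only [Matrix.of_apply, if_true, hval] at h1
    have h2 := h1 (fun h => hnd (Int.dvd_of_emod_eq_zero h))
    have h3 := Int.emod_nonneg (M' j 0) hd0
    have h4 := Int.emod_lt_of_pos (M' j 0) (show (0:ℤ) < d by omega)
    omega
  -- move to the corner and make it positive
  obtain ⟨M₂, hE₂, h₂⟩ : ∃ M₂, ElemEq M M₂ ∧ M₂ 0 0 = d := by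
    have hP : ElemEq M (Matrix.of fun i j => M₁ (Equiv.swap 0 i₁ i) (Equiv.swap 0 j₁ j)) :=
      hE₁.trans (.perm _ _ fun i j => rfl)
    rcases Int.natAbs_eq (M₁ i₁ j₁) with h | h
    · exact ⟨_, hP, by simp only [Matrix.of_apply, Equiv.swap_apply_left]; omega⟩
    · refine ⟨_, hP.trans (.neg (M' := Matrix.of fun i j =>
        ((-1 : ℤˣ) : ℤ) * M₁ (Equiv.swap 0 i₁ i) (Equiv.swap 0 j₁ j)) (fun _ => -1)
        fun i j => rfl), ?_⟩
      simp only [Matrix.of_apply, Equiv.swap_apply_left, Units.val_neg, Units.val_one]; omega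
  -- clear the first column
  choose q hq using hremc M₂ hE₂ h₂
  obtain ⟨M₃, hE₃, h₃, h₃c⟩ : ∃ M₃, ElemEq M M₃ ∧ M₃ 0 0 = d ∧ ∀ i : Fin m, M₃ i.succ 0 = 0 := by
    refine ⟨Matrix.of fun i j => M₂ i j + (Fin.cons 0 (fun i => - q i.succ) : Fin (m+1) → ℤ) i
      * M₂ 0 j, hE₂.trans (.addRow 0 (Fin.cons 0 (fun i => - q i.succ)) rfl fun i j => rfl), ?_, ?_⟩
    · simp [h₂]
    · intro i
      simp only [Matrix.of_apply, Fin.cons_succ, h₂, hq i.succ]; ring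
  -- clear the first row
  choose p hp using hrem M₃ hE₃ h₃
  obtain ⟨M₄, hE₄, h₄, h₄c, h₄r⟩ : ∃ M₄, ElemEq M M₄ ∧ M₄ 0 0 = d ∧
      (∀ i : Fin m, M₄ i.succ 0 = 0) ∧ ∀ j : Fin n, M₄ 0 j.succ = 0 := by
    refine ⟨Matrix.of fun i j => M₃ i j + M₃ i 0 *
      (Fin.cons 0 (fun i => - p i.succ) : Fin (n+1) → ℤ) j,
      hE₃.trans (.addCol 0 (Fin.cons 0 (fun i => - p i.succ)) rfl fun i j => rfl), ?_, ?_, ?_⟩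
    · simp [h₃]
    · intro i
      simp [h₃c]
    · intro i
      simp only [Matrix.of_apply, Fin.cons_succ, h₃, hp i.succ]; ring
  refine ⟨d, Matrix.of fun i j => M₄ i.succ j.succ, by omega, ?_, ?_⟩
  · intro i j
    have hE5 : ElemEq M (Matrix.of fun l j => M₄ l j + (if l = 0 then 1 else 0) * M₄ i.succ j) :=
      hE₄.trans (.addRow i.succ (fun l => if l = 0 then 1 else 0)
        (by simp) fun i l => rfl)
    have := hrem _ hE5 (by simp [h₄, h₄c]) j.succ
    simpa [h₄r] using this
  · have : blk d (Matrix.of fun i j => M₄ i.succ j.succ) = M₄ := by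
      ext i j
      cases i using Fin.cases <;> cases j using Fin.cases <;> simp [h₄, h₄c, h₄r]
    rw [this]; exact hE₄

lemma exists_snf : ∀ (m : ℕ) {n : ℕ} (M : Matrix (Fin m) (Fin n) ℤ),
    ∃ M', ElemEq M M' ∧ IsSmithNormalForm M' := by
  intro m
  induction m with
  | zero => exact fun M => ⟨M, .refl _, 0, fun i => i.elim0, fun i => i.elim0, fun i => i.elim0⟩
  | succ m ih =>
    intro n M
    by_cases hM : M = 0
    · subst hM
      exact ⟨0, .refl _, 0, fun _ _ _ => rfl, fun _ _ _ h => absurd h (by omega),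
        fun _ _ _ _ _ _ _ h => absurd h (by omega)⟩
    cases n with
    | zero => exact absurd (by ext i j; exact j.elim0) hM
    | succ n =>
      obtain ⟨d, N, hd, hdvd, hE⟩ := exists_blk M hM
      obtain ⟨N', hN, r, h1, h2, h3⟩ := ih N
      refine ⟨blk d N', hE.trans (hN.lift d), r + 1, ?_, ?_, ?_⟩
      · intro i j
        cases i using Fin.cases <;> cases j using Fin.cases <;> simp
        exact h1 _ _
      · intro i j
        cases i using Fin.cases <;> cases j using Fin.cases <;> simp [hd]
        exact h2 _ _
      · intro i i' j j'
        cases i using Fin.cases <;> cases j using Fin.cases <;> cases i' using Fin.cases <;>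
          cases j' using Fin.cases <;> simp [hN.dvd d hdvd]
        exact h3 _ _ _ _

/-- Exponent sum as a homomorphism. -/
def expHom {n : ℕ} (j : Fin n) : FreeGroup (Fin n) →* Multiplicative ℤ :=
  FreeGroup.lift fun i => Multiplicative.ofAdd (if i = j then (1 : ℤ) else 0)

lemma expSum_eq {n : ℕ} (j : Fin n) (w) : expSum j w = Multiplicative.toAdd (expHom j w) := rfl

lemma expSum_mul {n : ℕ} (j : Fin n) (v w) : expSum j (v * w) = expSum j v + expSum j w := by
  simp [expSum_eq]

lemma expSum_zpow {n : ℕ} (j : Fin n) (v) (c : ℤ) : expSum j (v ^ c) = c * expSum j v := by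
  simp [expSum_eq]

lemma expSum_inv {n : ℕ} (j : Fin n) (v) : expSum j v⁻¹ = - expSum j v := by
  simp [expSum_eq]

lemma expSum_one {n : ℕ} (j : Fin n) : expSum j 1 = 0 := by
  simp [expSum_eq]

lemma expSum_of {n : ℕ} (j i : Fin n) : expSum j (FreeGroup.of i) = if i = j then 1 else 0 := by
  simp [expSum]

lemma rel_iso_of_equiv {n m : ℕ} (R : Fin m → FreeGroup (Fin n))
    (φ : FreeGroup (Fin n) ≃* FreeGroup (Fin n)) :
    Nonempty (MetabelianPresented (Set.range R) ≃*
      MetabelianPresented (Set.range fun i => φ (R i))) := by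
  refine ⟨QuotientGroup.congr _ _ φ ?_⟩
  unfold metabelianRel
  have h2 := map_derivedSeries_eq (f := (φ : FreeGroup (Fin n) →* FreeGroup (Fin n)))
    φ.surjective 2
  rw [Subgroup.map_normalClosure _ _ φ.surjective, Set.image_union, ← Set.range_comp,
    ← Subgroup.coe_map, h2]
  rfl

lemma rel_iso_of_eq {n m : ℕ} {R R' : Fin m → FreeGroup (Fin n)}
    (h : ∀ i, R i ∈ metabelianRel (Set.range R')) (h' : ∀ i, R' i ∈ metabelianRel (Set.range R)) :
    Nonempty (MetabelianPresented (Set.range R) ≃* MetabelianPresented (Set.range R')) := by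
  refine ⟨QuotientGroup.quotientMulEquivOfEq (le_antisymm ?_ ?_)⟩
  · refine Subgroup.normalClosure_le_normal (Set.union_subset ?_ ?_)
    · rintro _ ⟨i, rfl⟩; exact h i
    · exact Set.subset_union_right.trans Subgroup.subset_normalClosure
  · refine Subgroup.normalClosure_le_normal (Set.union_subset ?_ ?_)
    · rintro _ ⟨i, rfl⟩; exact h' i
    · exact Set.subset_union_right.trans Subgroup.subset_normalClosure

lemma mem_rel {n m : ℕ} (R : Fin m → FreeGroup (Fin n)) (i : Fin m) :
    R i ∈ metabelianRel (Set.range R) :=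
  Subgroup.subset_normalClosure (Or.inl ⟨i, rfl⟩)

/-- The endomorphism sending `a_k` to `a_k * w` and fixing other generators. -/
def mulGen {n : ℕ} (k : Fin n) (w : FreeGroup (Fin n)) : FreeGroup (Fin n) →* FreeGroup (Fin n) :=
  FreeGroup.lift fun i => if i = k then FreeGroup.of k * w else FreeGroup.of i

lemma mulGen_of {n : ℕ} (k : Fin n) (w : FreeGroup (Fin n)) (i : Fin n) :
    mulGen k w (FreeGroup.of i) = if i = k then FreeGroup.of k * w else FreeGroup.of i := by
  simp [mulGen]

lemma mulGen_comp {n : ℕ} (k : Fin n) (v w : FreeGroup (Fin n)) (hw : mulGen k v w = w)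
    (hvw : v * w = 1) : (mulGen k v).comp (mulGen k w) = MonoidHom.id _ := by
  ext i
  simp only [MonoidHom.comp_apply, mulGen_of, MonoidHom.id_apply]
  split_ifs with h
  · rw [map_mul, hw, mulGen_of, if_pos rfl, mul_assoc, hvw, mul_one, h]
  · rw [mulGen_of, if_neg h]

/-- A word with prescribed exponent sums. -/
def genWord {n : ℕ} (c : Fin n → ℤ) : FreeGroup (Fin n) :=
  (List.ofFn fun j => FreeGroup.of j ^ c j).prod

lemma expSum_genWord {n : ℕ} (c : Fin n → ℤ) (l : Fin n) : expSum l (genWord c) = c l := by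
  rw [expSum_eq, genWord, map_list_prod, List.map_ofFn, List.prod_ofFn, toAdd_prod]
  have : ∀ j, Multiplicative.toAdd (expHom l (FreeGroup.of j ^ c j)) =
      c j * if j = l then 1 else 0 := by
    intro j; rw [← expSum_eq, expSum_zpow, expSum_of]
  simp only [Function.comp_apply, this]
  simp

lemma mulGen_genWord {n : ℕ} (k : Fin n) (v : FreeGroup (Fin n)) (c : Fin n → ℤ) (hc : c k = 0) :
    mulGen k v (genWord c) = genWord c := by
  rw [genWord, map_list_prod, List.map_ofFn]
  congr 2
  funext j
  simp only [Function.comp_apply, map_zpow, mulGen_of]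
  split_ifs with h
  · subst h; simp [hc]
  · rfl

/-- The automorphism realizing a column operation. -/
def colAut {n : ℕ} (k : Fin n) (c : Fin n → ℤ) (hc : c k = 0) :
    FreeGroup (Fin n) ≃* FreeGroup (Fin n) :=
  MonoidHom.toMulEquiv (mulGen k (genWord c)) (mulGen k (genWord c)⁻¹)
    (mulGen_comp k _ _ (mulGen_genWord k _ c hc) (by simp))
    (mulGen_comp k _ _ (by rw [map_inv, mulGen_genWord k _ c hc]) (by simp))

lemma expSum_mulGen {n : ℕ} (k : Fin n) (c : Fin n → ℤ) (j : Fin n) (v : FreeGroup (Fin n)) :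
    expSum j (mulGen k (genWord c) v) = expSum j v + expSum k v * c j := by
  induction v using FreeGroup.induction_on with
  | C1 => simp [expSum_one]
  | of i =>
    simp only [mulGen_of, expSum_of]
    split_ifs with h h' h' <;> simp_all [expSum_mul, expSum_of, expSum_genWord]
  | inv_of i ih => 
    simp only [map_inv, expSum_inv] at ih ⊢
    rw [ih]; ring
  | mul x y hx hy => 
    simp only [map_mul, expSum_mul, hx, hy]; ring

lemma expSum_perm {n : ℕ} (τ : Equiv.Perm (Fin n)) (j : Fin n) (v : FreeGroup (Fin n)) :
    expSum j (FreeGroup.freeGroupCongr τ.symm v) = expSum (τ j) v := by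
  induction v using FreeGroup.induction_on with
  | C1 => simp [expSum_one]
  | of i => simp [expSum_of, Equiv.symm_apply_eq]
  | inv_of i ih => 
    simp only [map_inv, expSum_inv] at ih ⊢
    rw [ih]
  | mul x y hx hy => 
    simp only [map_mul, expSum_mul, hx, hy]

lemma ElemEq.realize {m n : ℕ} {M M' : Matrix (Fin m) (Fin n) ℤ} (h : ElemEq M M') :
    ∀ R : Fin m → FreeGroup (Fin n), relMatrix R = M → ∃ R' : Fin m → FreeGroup (Fin n),
      relMatrix R' = M' ∧
      Nonempty (MetabelianPresented (Set.range R) ≃* MetabelianPresented (Set.range R')) := by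
  induction h with
  | refl M => exact fun R hR => ⟨R, hR, ⟨MulEquiv.refl _⟩⟩
  | trans _ _ h1 h2 =>
    intro R hR
    obtain ⟨R₁, hR₁, ⟨e₁⟩⟩ := h1 R hR
    obtain ⟨R₂, hR₂, ⟨e₂⟩⟩ := h2 R₁ hR₁
    exact ⟨R₂, hR₂, ⟨e₁.trans e₂⟩⟩
  | addRow k c hc h =>
    rintro R rfl
    refine ⟨fun i => R i * R k ^ c i, ?_, rel_iso_of_eq (fun i => ?_) fun i => ?_⟩
    · ext i j
      rw [h]; simp [relMatrix, expSum_mul, expSum_zpow]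
    · have h1 := mem_rel (fun i => R i * R k ^ c i) i
      have h2 := mem_rel (fun i => R i * R k ^ c i) k
      simp only [hc, zpow_zero, mul_one] at h2
      exact (Subgroup.mul_mem_cancel_right _ (Subgroup.zpow_mem _ h2 (c i))).mp h1
    · exact Subgroup.mul_mem _ (mem_rel R i) (Subgroup.zpow_mem _ (mem_rel R k) _)
  | addCol k c hc h =>
    rintro R rfl
    refine ⟨fun i => colAut k c hc (R i), ?_, rel_iso_of_equiv R _⟩
    ext i j
    rw [h]; exact expSum_mulGen k c j (R i)
  | perm σ τ h =>
    rintro R rfl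
    obtain ⟨e⟩ := rel_iso_of_equiv (fun i => R (σ i)) (FreeGroup.freeGroupCongr τ.symm)
    obtain ⟨e'⟩ := rel_iso_of_eq (R := R) (R' := fun i => R (σ i))
      (fun i => by simpa using mem_rel (fun i => R (σ i)) (σ.symm i)) (fun i => mem_rel R (σ i))
    refine ⟨_, ?_, ⟨e'.trans e⟩⟩
    ext i j
    rw [h]; exact expSum_perm τ j _
  | neg s h =>
    rintro R rfl
    refine ⟨fun i => R i ^ (s i : ℤ), ?_, rel_iso_of_eq (fun i => ?_) fun i => ?_⟩
    · ext i j
      rw [h]; simp [relMatrix, expSum_zpow]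
    · have h1 := mem_rel (fun i => R i ^ (s i : ℤ)) i
      rcases Int.units_eq_one_or (s i) with hs | hs <;> simpa [hs] using h1
    · exact Subgroup.zpow_mem _ (mem_rel R i) _

/-- Every finite presentation with `n` generators and `m` relators can be
replaced by one of the same size whose relation matrix is in Smith normal form, with the
same rank, presenting an isomorphic metabelian group. -/
theorem exists_smith_normal_form_presentation {n m : ℕ} (R : Fin m → FreeGroup (Fin n)) :
    ∃ R' : Fin m → FreeGroup (Fin n),
      IsSmithNormalForm (relMatrix R') ∧
      (relMatrix R).rank = (relMatrix R').rank ∧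
      Nonempty (MetabelianPresented (Set.range R) ≃* MetabelianPresented (Set.range R')) := by
  obtain ⟨M', hE, hS⟩ := exists_snf m (relMatrix R)
  obtain ⟨R', rfl, e⟩ := hE.realize R rfl
  exact ⟨R', hS, hE.rank_eq, e⟩
end

section
/- Let m ≤ n and let G = ⟨a_1,…,a_n ∣ a_1^{α_1} = c_1, …, a_m^{α_m} = c_m⟩_M be a metabelian presented group, where each c_i lies in the derived subgroup [F(A),F(A)] of the free group F(A) and each α_i is a nonzero integer (so the presentation is in Smith normal form and has full rank). Then: (1) K = ⟨a_1,…,a_m⟩ is virtually abelian, and its normal closure L = K^G in G is virtually abelian; (2) H = ⟨a_{m+1},…,a_n⟩ is a free metabelian group of rank n − m, freely generated by the images of a_{m+1},…,a_n; (3) G is generated by H together with K, and G = H·L. -/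
/-- Affine group: pairs `(x, t)` with `t` acting on `x` through `ρ`. -/
@[ext] structure MAff {Q A : Type} [CommGroup Q] [CommRing A] (ρ : Q →* A) (V : Type) where
  x : V
  t : Q

namespace MAff

variable {Q A V : Type} [CommGroup Q] [CommRing A] {ρ : Q →* A} [AddCommGroup V] [Module A V]

instance : Mul (MAff ρ V) := ⟨fun a b => ⟨a.x + ρ a.t • b.x, a.t * b.t⟩⟩
instance : One (MAff ρ V) := ⟨⟨0, 1⟩⟩
instance : Inv (MAff ρ V) := ⟨fun a => ⟨-(ρ a.t⁻¹ • a.x), a.t⁻¹⟩⟩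

@[simp] lemma mul_x (a b : MAff ρ V) : (a * b).x = a.x + ρ a.t • b.x := rfl
@[simp] lemma mul_t (a b : MAff ρ V) : (a * b).t = a.t * b.t := rfl
@[simp] lemma one_x : (1 : MAff ρ V).x = 0 := rfl
@[simp] lemma one_t : (1 : MAff ρ V).t = 1 := rfl
@[simp] lemma inv_x (a : MAff ρ V) : (a⁻¹).x = -(ρ a.t⁻¹ • a.x) := rfl
@[simp] lemma inv_t (a : MAff ρ V) : (a⁻¹).t = a.t⁻¹ := rfl

instance : Group (MAff ρ V) := Group.ofLeftAxioms
  (fun a b c => by ext <;> simp [mul_smul, smul_add, add_assoc, mul_assoc])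
  (fun a => by ext <;> simp)
  (fun a => by ext <;> simp)

/-- projection -/
def tHom : MAff ρ V →* Q where
  toFun := MAff.t
  map_one' := rfl
  map_mul' _ _ := rfl

lemma derived_two : derivedSeries (MAff ρ V) 2 = ⊥ := by
  rw [derivedSeries_succ, derivedSeries_one, eq_bot_iff, Subgroup.commutator_le]
  intro a ha b hb
  have ha' : a.t = 1 := Abelianization.commutator_subset_ker (tHom (ρ := ρ) (V := V)) ha
  have hb' : b.t = 1 := Abelianization.commutator_subset_ker (tHom (ρ := ρ) (V := V)) hb
  rw [Subgroup.mem_bot, commutatorElement_eq_one_iff_mul_comm]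
  ext <;> simp [ha', hb', add_comm]

/-- functoriality -/
def mapHom {V' : Type} [AddCommGroup V'] [Module A V'] (L : V →ₗ[A] V') :
    MAff ρ V →* MAff ρ V' where
  toFun a := ⟨L a.x, a.t⟩
  map_one' := by ext <;> simp
  map_mul' a b := by ext <;> simp

/-- the hom to the coefficients -/
def augHom (ε : A →+* ℤ) (hε : ∀ q, ε (ρ q) = 1) {β : Type} (b : β) :
    MAff ρ (β → A) →* Multiplicative ℤ where
  toFun a := Multiplicative.ofAdd (ε (a.x b))
  map_one' := by simp
  map_mul' u v := by simp [hε]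

variable (ρ)

/-- The hom from the free group. -/
def psi {β : Type} (τ : β → Q) (y : β → V) : FreeGroup β →* MAff ρ V :=
  FreeGroup.lift fun b => ⟨y b, τ b⟩

lemma psi_t {β : Type} (τ : β → Q) (y : β → V) (w : FreeGroup β) :
    (psi ρ τ y w).t = FreeGroup.lift τ w := by
  have : tHom.comp (psi ρ τ y) = FreeGroup.lift τ := by
    ext b; simp [psi, tHom]
  exact DFunLike.congr_fun this w

/-- Fox derivative -/
noncomputable def fox {β : Type} [DecidableEq β] (τ : β → Q) (w : FreeGroup β) : β → A :=
  (psi ρ τ (fun b => (Pi.single b 1 : β → A)) w).x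

lemma psi_x {β : Type} [DecidableEq β] [Fintype β] (τ : β → Q) (y : β → V) (w : FreeGroup β) :
    (psi ρ τ y w).x = ∑ b, fox ρ τ w b • y b := by
  have : psi ρ τ y = (mapHom (Fintype.linearCombination A y)).comp
      (psi ρ τ (fun b => (Pi.single b 1 : β → A))) := by
    ext b <;> simp [psi, mapHom]
  rw [this]
  simp [mapHom, fox, Fintype.linearCombination_apply]

lemma fox_mul {β : Type} [DecidableEq β] (τ : β → Q) (u v : FreeGroup β) :
    fox ρ τ (u * v) = fox ρ τ u + ρ (FreeGroup.lift τ u) • fox ρ τ v := by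
  simp [fox, psi_t]

lemma fox_aug (ε : A →+* ℤ) (hε : ∀ q, ε (ρ q) = 1) {β : Type} [DecidableEq β] (τ : β → Q)
    (w : FreeGroup β) (hw : w ∈ commutator (FreeGroup β)) (b : β) : ε (fox ρ τ w b) = 0 := by
  have := Abelianization.commutator_subset_ker
    ((augHom ε hε b).comp (psi ρ τ (fun b => (Pi.single b 1 : β → A)))) hw
  simpa [augHom, fox] using this

lemma lift_comm {β : Type} (τ : β → Q) (w : FreeGroup β) (hw : w ∈ commutator (FreeGroup β)) :
    FreeGroup.lift τ w = 1 :=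
  Abelianization.commutator_subset_ker (FreeGroup.lift τ) hw

end MAff

section Magnus
open MAff

variable (κ : Type)

/-- abelianization of the free group -/
abbrev QQ := Abelianization (FreeGroup κ)

/-- its group ring -/
abbrev AA := MonoidAlgebra ℤ (QQ κ)

instance : UniqueProds (QQ κ) := by
  have h : TwoUniqueSums (Additive (QQ κ)) :=
    inferInstanceAs (TwoUniqueSums (FreeAbelianGroup κ))
  have h2 : UniqueProds (Multiplicative (Additive (QQ κ))) := inferInstance
  exact UniqueProds.of_injective_mulHom
    (G := Multiplicative (Additive (QQ κ)))
    ⟨fun x => Multiplicative.ofAdd (Additive.ofMul x), fun _ _ => rfl⟩ (fun _ _ h => h) h2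

instance : IsDomain (AA κ) := NoZeroDivisors.to_isDomain _

variable {κ}

/-- generators -/
abbrev tau (j : κ) : QQ κ := Abelianization.of (FreeGroup.of j)

lemma lift_tau (w : FreeGroup κ) : FreeGroup.lift tau w = Abelianization.of w := by
  have : FreeGroup.lift tau = (Abelianization.of : FreeGroup κ →* QQ κ) := by ext j; simp
  rw [this]

/-- A set-theoretic section of the abelianization. -/
noncomputable def sec (q : QQ κ) : FreeGroup κ :=
  Function.surjInv (QuotientGroup.mk'_surjective (commutator (FreeGroup κ))) q

lemma of_sec (q : QQ κ) : Abelianization.of (sec q) = q :=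
  Function.surjInv_eq (QuotientGroup.mk'_surjective (commutator (FreeGroup κ))) q

/-- Schreier-type element. -/
noncomputable def gam (q : QQ κ) (u : FreeGroup κ) : commutator (FreeGroup κ) :=
  ⟨sec q * u * (sec (q * Abelianization.of u))⁻¹, by
    refine (Abelianization.ker_of _).le ?_
    rw [MonoidHom.mem_ker]
    simp [of_sec]⟩

/-- class -/
noncomputable def cl (q : QQ κ) (u : FreeGroup κ) :
    Additive (Abelianization (commutator (FreeGroup κ))) :=
  Additive.ofMul (Abelianization.of (gam q u))

lemma cl_mul (q : QQ κ) (u v : FreeGroup κ) :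
    cl q (u * v) = cl q u + cl (q * Abelianization.of u) v := by
  rw [cl, cl, cl, ← ofMul_mul, ← map_mul]
  congr 2
  ext
  simp [gam, mul_assoc]

variable [Fintype κ] [DecidableEq κ]

/-- The map from chains to the relation module. -/
noncomputable def theta : (κ → AA κ) →+ Additive (Abelianization (commutator (FreeGroup κ))) :=
  ∑ j, ((Finsupp.liftAddHom fun q : QQ κ =>
    (zmultiplesHom (Additive (Abelianization (commutator (FreeGroup κ))))
      (cl q (FreeGroup.of j)))).comp
    (MonoidAlgebra.coeffAddEquiv (R := ℤ) (M := QQ κ)).toAddMonoidHom).comp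
      (Pi.evalAddMonoidHom (fun _ => AA κ) j)

lemma theta_single (q : QQ κ) (j : κ) :
    theta (MonoidAlgebra.of ℤ (QQ κ) q • (Pi.single j 1 : κ → AA κ)) = cl q (FreeGroup.of j) := by
  rw [theta, AddMonoidHom.finsetSum_apply, Finset.sum_eq_single j]
  · have h : (MonoidAlgebra.coeffAddEquiv (R := ℤ) (M := QQ κ)).toAddMonoidHom
        (MonoidAlgebra.single q 1) = Finsupp.single q 1 := rfl
    simp [h]
  · intro b _ hb
    simp [hb]
  · simp

lemma theta_fox (u : FreeGroup κ) : ∀ q : QQ κ,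
    theta (MonoidAlgebra.of ℤ (QQ κ) q • fox (MonoidAlgebra.of ℤ (QQ κ)) tau u) = cl q u := by
  have hone : ∀ q : QQ κ, cl q 1 = 0 := by
    intro q
    have := cl_mul q 1 1
    simpa using this
  induction u using FreeGroup.induction_on with
  | C1 => intro q; rw [hone]; simp [fox]
  | of j => intro q; rw [← theta_single]; simp [fox, psi]
  | inv_of j ih =>
    intro q
    have h1 := fox_mul (MonoidAlgebra.of ℤ (QQ κ)) tau (FreeGroup.of j)⁻¹ (FreeGroup.of j)
    have h2 := cl_mul q (FreeGroup.of j)⁻¹ (FreeGroup.of j)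
    rw [inv_mul_cancel, lift_tau] at h1
    rw [inv_mul_cancel, hone, ← ih] at h2
    have h0 : fox (MonoidAlgebra.of ℤ (QQ κ)) tau (1 : FreeGroup κ) = 0 := by simp [fox]
    rw [h0] at h1
    rw [eq_neg_of_add_eq_zero_left h1.symm, eq_neg_of_add_eq_zero_left h2.symm, smul_neg, map_neg,
      smul_smul, ← map_mul]
  | mul u v hu hv =>
    intro q
    rw [fox_mul, cl_mul, lift_tau, smul_add, map_add, hu, smul_smul, ← map_mul, hv]

lemma magnus (w : FreeGroup κ) (hw : Abelianization.of w = 1)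
    (hf : fox (MonoidAlgebra.of ℤ (QQ κ)) tau w = 0) : w ∈ derivedSeries (FreeGroup κ) 2 := by
  have h := theta_fox w 1
  rw [hf, smul_zero, map_zero] at h
  have h1 : gam 1 w ∈ commutator (commutator (FreeGroup κ)) := by
    refine (Abelianization.ker_of _).le ?_
    exact h.symm
  have h2 := Subgroup.mem_map_of_mem (commutator (FreeGroup κ)).subtype h1
  rw [Subgroup.map_subtype_commutator] at h2
  rw [derivedSeries_succ, derivedSeries_one]
  have h3 : ((commutator (FreeGroup κ)).subtype (gam 1 w)) =
      sec (1 : QQ κ) * w * (sec (1 : QQ κ))⁻¹ := by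
    simp [gam, hw]
  rw [h3] at h2
  have h4 := (inferInstance : (⁅commutator (FreeGroup κ), commutator (FreeGroup κ)⁆).Normal).conj_mem
    _ h2 (sec (1 : QQ κ))⁻¹
  simpa [mul_assoc] using h4

theorem core {ι : Type} [Fintype ι] [DecidableEq ι] (α : ι → ℤ) (hα : ∀ i, α i ≠ 0)
    (c : ι → FreeGroup (ι ⊕ κ)) (hc : ∀ i, c i ∈ commutator (FreeGroup (ι ⊕ κ))) :
    ∃ (W : Type) (_ : Group W) (Φ : FreeGroup (ι ⊕ κ) →* W), derivedSeries W 2 = ⊥ ∧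
      (∀ i, Φ (FreeGroup.of (Sum.inl i)) ^ α i = Φ (c i)) ∧
      ∀ w : FreeGroup κ, Φ (FreeGroup.map Sum.inr w) = 1 → w ∈ derivedSeries (FreeGroup κ) 2 := by
  classical
  set ρ := MonoidAlgebra.of ℤ (QQ κ) with hρ
  let τ : ι ⊕ κ → QQ κ := Sum.elim (fun _ => 1) tau
  let ε : AA κ →+* ℤ := (MonoidAlgebra.lift ℤ ℤ (QQ κ) 1).toRingHom
  have hε : ∀ q, ε (ρ q) = 1 := by intro q; simp [ε, ρ]
  let M : Matrix ι ι (AA κ) := Matrix.of fun i l =>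
    (if i = l then (α i : AA κ) else 0) - fox ρ τ (c i) (Sum.inl l)
  have hd : M.det ≠ 0 := by
    intro h0
    have h1 : ε M.det = ∏ i, α i := by
      rw [RingHom.map_det, ← Matrix.det_diagonal]
      congr 1
      ext i l
      simp only [M, RingHom.mapMatrix_apply, Matrix.map_apply, Matrix.of_apply, map_sub,
        fox_aug ρ ε hε τ (c i) (hc i), Matrix.diagonal_apply]
      split_ifs <;> simp
    rw [h0, map_zero] at h1
    exact Finset.prod_ne_zero_iff.mpr (fun i _ => hα i) h1.symm
  let b : ι → (κ → AA κ) := fun i => ∑ j, fox ρ τ (c i) (Sum.inr j) • (Pi.single j 1 : κ → AA κ)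
  let X : ι → (κ → AA κ) := fun i => ∑ l, M.adjugate i l • b l
  have hX : ∀ i, ∑ l, M i l • X l = M.det • b i := by
    intro i
    simp only [X, Finset.smul_sum, smul_smul]
    rw [Finset.sum_comm]
    simp only [← Finset.sum_smul]
    have : ∀ l, ∑ x, M i x * M.adjugate x l = if i = l then M.det else 0 := by
      intro l
      rw [← Matrix.mul_apply, Matrix.mul_adjugate]
      simp [Matrix.one_apply]
    simp [this]
  let y : ι ⊕ κ → (κ → AA κ) := Sum.elim X (fun j => M.det • Pi.single j 1)
  refine ⟨MAff ρ (κ → AA κ), inferInstance, psi ρ τ y, derived_two, ?_, ?_⟩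
  · intro i
    have hp : ∀ k : ℤ, (psi ρ τ y (FreeGroup.of (Sum.inl i)) ^ k) = ⟨(k : AA κ) • X i, 1⟩ := by
      have h1 : psi ρ τ y (FreeGroup.of (Sum.inl i)) = ⟨X i, 1⟩ := by simp [psi, y, τ]
      intro k
      rw [h1]
      induction k using Int.induction_on with
      | zero => ext <;> simp
      | succ k ih => rw [zpow_add_one, ih]; ext <;> simp [add_mul]
      | pred k ih => rw [zpow_sub_one, ih]; ext <;> simp [sub_mul, add_mul, sub_eq_add_neg]
    rw [hp]
    refine MAff.ext ?_ ?_
    · rw [psi_x, Fintype.sum_sum_type]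
      have h := hX i
      simp only [M, Matrix.of_apply, sub_smul, Finset.sum_sub_distrib] at h
      simp only [ite_smul, zero_smul, Finset.sum_ite_eq, Finset.mem_univ, if_true] at h
      rw [sub_eq_iff_eq_add] at h
      simp only [y, Sum.elim_inl, Sum.elim_inr]
      rw [h, add_comm]
      congr 1
      simp only [b, Finset.smul_sum]
      exact Finset.sum_congr rfl fun j _ => smul_comm _ _ _
    · rw [psi_t, lift_comm τ _ (hc i)]
  · intro w hw
    have hcomp : (psi ρ τ y).comp (FreeGroup.map Sum.inr) =
        psi ρ tau (fun j => M.det • (Pi.single j 1 : κ → AA κ)) := by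
      ext j <;> simp [psi, y, τ]
    have hw' : psi ρ tau (fun j => M.det • (Pi.single j 1 : κ → AA κ)) w = 1 := by
      rw [← hcomp]; exact hw
    apply magnus
    · have := congrArg MAff.t hw'
      rwa [psi_t, lift_tau] at this
    · have := congrArg MAff.x hw'
      rw [psi_x] at this
      funext j
      have h2 := congrFun this j
      simp [Finset.sum_apply, Pi.single_apply, hd] at h2
      exact h2

end Magnus

lemma virtAb {G : Type} [Group G] (hG : derivedSeries G 2 = ⊥) (T : Subgroup (Abelianization G))
    [Finite T] (L : Subgroup G) (hL : L ≤ T.comap Abelianization.of) : VirtuallyAbelian L := by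
  refine ⟨(Abelianization.of.comp L.subtype).ker, ?_, ?_⟩
  · intro x hx y hy
    have key : ∀ z : L, z ∈ (Abelianization.of.comp L.subtype).ker → (z : G) ∈ commutator G := by
      intro z hz
      rw [← Abelianization.ker_of]; exact hz
    have h := Subgroup.commutator_mem_commutator (key x hx) (key y hy)
    rw [derivedSeries_succ, derivedSeries_one] at hG
    rw [hG, Subgroup.mem_bot, commutatorElement_eq_one_iff_mul_comm] at h
    exact Subtype.ext h
  · have : Finite (Abelianization.of.comp L.subtype).range := by
      apply Set.Finite.subset (s := (T : Set (Abelianization G))) (Set.toFinite _)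
      rintro _ ⟨z, rfl⟩
      exact hL z.2
    exact Subgroup.finiteIndex_ker _

lemma finite_closure {A : Type} [CommGroup A] (S : Set A) (hS : S.Finite)
    (h : ∀ s ∈ S, IsOfFinOrder s) : Finite (Subgroup.closure S) := by
  have := hS.to_subtype
  have hfg : Group.FG (Subgroup.closure S) := Group.closure_finite_fg S
  apply CommGroup.finite_of_fg_isMulTorsion
  have hle : Subgroup.closure S ≤ CommGroup.torsion A := (Subgroup.closure_le _).mpr h
  intro x
  exact Submonoid.isOfFinOrder_coe.mp (hle x.2)



/-- Structure of a metabelian group presented in full-rank Smith normal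
form `⟨a_1,…,a_n ∣ a_1^{α_1} = c_1, …, a_m^{α_m} = c_m⟩_M` with `c_i ∈ [F,F]` and
`α_i ≠ 0`: the first `m` generators generate a virtually abelian subgroup `K` with virtually
abelian normal closure, the last `n-m` generators generate a free metabelian subgroup `H`
of rank `n-m`, and `G = ⟨H,K⟩ = H·K^G`. -/
theorem smith_normal_form_structure {n m : ℕ} (hmn : m ≤ n)
    (α : Fin m → ℤ) (hα : ∀ i, α i ≠ 0)
    (c : Fin m → FreeGroup (Fin n)) (hc : ∀ i, c i ∈ commutator (FreeGroup (Fin n)))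
    (R : Fin m → FreeGroup (Fin n))
    (hR : ∀ i, R i = FreeGroup.of (Fin.castLE hmn i) ^ α i * (c i)⁻¹)
    (π : FreeGroup (Fin n) →* MetabelianPresented (Set.range R))
    (hπ : π = QuotientGroup.mk' (metabelianRel (Set.range R)))
    (K H : Subgroup (MetabelianPresented (Set.range R)))
    (hK : K = Subgroup.closure (Set.range fun i : Fin m => π (FreeGroup.of (Fin.castLE hmn i))))
    (hH : H = Subgroup.closure (Set.range fun j : Fin (n - m) =>
      π (FreeGroup.of (Fin.cast (Nat.sub_add_cancel hmn) (j.addNat m))))) :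
    VirtuallyAbelian ↥K ∧
    VirtuallyAbelian ↥(Subgroup.normalClosure (K : Set (MetabelianPresented (Set.range R)))) ∧
    (∃ φ : FreeMetabelian (n - m) →* MetabelianPresented (Set.range R),
      (∀ j : Fin (n - m), φ (QuotientGroup.mk (FreeGroup.of j)) =
        π (FreeGroup.of (Fin.cast (Nat.sub_add_cancel hmn) (j.addNat m)))) ∧
      Function.Injective φ ∧ φ.range = H) ∧
    H ⊔ K = ⊤ ∧
    (∀ g : MetabelianPresented (Set.range R), ∃ h ∈ H,
      ∃ l ∈ Subgroup.normalClosure (K : Set (MetabelianPresented (Set.range R))), g = h * l) := by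
  classical
  subst hπ
  generalize hS : Set.range R = S at K H hK hH ⊢
  let p : Fin m → Fin n := Fin.castLE hmn
  let q : Fin (n - m) → Fin n := fun j => Fin.cast (Nat.sub_add_cancel hmn) (j.addNat m)
  let e : Fin m ⊕ Fin (n - m) ≃ Fin n :=
    finSumFinEquiv.trans (finCongr (Nat.add_sub_of_le hmn))
  have hep : ∀ i, e (Sum.inl i) = p i := by
    intro i; apply Fin.ext; simp [e, p]
  have heq : ∀ j, e (Sum.inr j) = q j := by
    intro j; apply Fin.ext; simp [e, q, add_comm]
  have hG : derivedSeries (MetabelianPresented S) 2 = ⊥ := by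
    rw [eq_bot_iff, ← map_derivedSeries_eq (QuotientGroup.mk'_surjective (metabelianRel S)),
      Subgroup.map_le_iff_le_comap]
    intro x hx
    rw [Subgroup.mem_comap, Subgroup.mem_bot]
    exact (QuotientGroup.eq_one_iff x).mpr (Subgroup.subset_normalClosure (Or.inr hx))
  have hrel : ∀ i, QuotientGroup.mk' (metabelianRel S) (FreeGroup.of (p i)) ^ α i =
      QuotientGroup.mk' (metabelianRel S) (c i) := by
    intro i
    have h1 : QuotientGroup.mk' (metabelianRel S) (R i) = 1 :=
      (QuotientGroup.eq_one_iff _).mpr (Subgroup.subset_normalClosure (Or.inl (hS ▸ ⟨i, rfl⟩)))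
    rw [hR, map_mul, map_inv, map_zpow, mul_inv_eq_one] at h1
    exact h1
  let T : Subgroup (Abelianization (MetabelianPresented S)) := Subgroup.closure (Set.range
    fun i : Fin m => Abelianization.of (QuotientGroup.mk' (metabelianRel S) (FreeGroup.of (p i))))
  have hT : Finite T := by
    apply finite_closure _ (Set.finite_range _)
    rintro _ ⟨i, rfl⟩
    rw [isOfFinOrder_iff_zpow_eq_one]
    refine ⟨α i, hα i, ?_⟩
    show Abelianization.of (QuotientGroup.mk' (metabelianRel S) (FreeGroup.of (p i))) ^ α i = 1
    rw [← map_zpow, hrel]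
    exact Abelianization.commutator_subset_ker
      (Abelianization.of.comp (QuotientGroup.mk' (metabelianRel S))) (hc i)
  have hKT : K ≤ T.comap Abelianization.of := by
    rw [hK, Subgroup.closure_le]
    rintro _ ⟨i, rfl⟩
    exact Subgroup.subset_closure ⟨i, rfl⟩
  have hLT : Subgroup.normalClosure (K : Set (MetabelianPresented S)) ≤
      T.comap Abelianization.of := Subgroup.normalClosure_le_normal hKT
  have htop : H ⊔ K = ⊤ := by
    rw [eq_top_iff, ← MonoidHom.range_eq_top.mpr (QuotientGroup.mk'_surjective (metabelianRel S)),
      MonoidHom.range_eq_map, ← FreeGroup.closure_range_of, MonoidHom.map_closure,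
      Subgroup.closure_le]
    rintro _ ⟨_, ⟨a, rfl⟩, rfl⟩
    obtain ⟨s, rfl⟩ := e.surjective a
    rcases s with i | j
    · rw [hep]
      refine (le_sup_right : K ≤ H ⊔ K) ?_
      rw [hK]
      exact Subgroup.subset_closure ⟨i, rfl⟩
    · rw [heq]
      refine (le_sup_left : H ≤ H ⊔ K) ?_
      rw [hH]
      exact Subgroup.subset_closure ⟨j, rfl⟩
  refine ⟨virtAb hG T K hKT, virtAb hG T _ hLT, ?_, htop, ?_⟩
  · let f : FreeGroup (Fin (n - m)) →* MetabelianPresented S :=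
      (QuotientGroup.mk' (metabelianRel S)).comp (FreeGroup.map q)
    have hf : derivedSeries (FreeGroup (Fin (n - m))) 2 ≤ f.ker := by
      intro x hx
      have := map_derivedSeries_le_derivedSeries f 2 (Subgroup.mem_map_of_mem f hx)
      rw [hG] at this
      exact this
    refine ⟨QuotientGroup.lift _ f hf, ?_, ?_, ?_⟩
    · intro j
      show f (FreeGroup.of j) = _
      simp [f, q]
    · rw [injective_iff_map_eq_one]
      intro x
      induction x using QuotientGroup.induction_on with
      | H w =>
      intro hw
      have hw1 : FreeGroup.map q w ∈ metabelianRel S := (QuotientGroup.eq_one_iff _).mp hw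
      obtain ⟨W, _, Φ, hW, hΦ, hΦ'⟩ := core (κ := Fin (n - m)) α hα
        (fun i => FreeGroup.map e.symm (c i)) (fun i => by
          have := map_derivedSeries_le_derivedSeries (FreeGroup.map e.symm) 1
            (Subgroup.mem_map_of_mem _ (by rw [derivedSeries_one]; exact hc i))
          rwa [derivedSeries_one] at this)
      have hle : metabelianRel S ≤ (Φ.comp (FreeGroup.map e.symm)).ker := by
        apply Subgroup.normalClosure_le_normal
        rw [← hS]
        rintro x (⟨i, rfl⟩ | hx)
        · show Φ (FreeGroup.map e.symm (R i)) = 1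
          have h3 : e.symm (Fin.castLE hmn i) = Sum.inl i := by
            rw [Equiv.symm_apply_eq, hep]
          rw [hR, map_mul, map_mul, map_inv, map_inv, map_zpow, map_zpow, FreeGroup.map.of, h3,
            hΦ, mul_inv_cancel]
        · have := map_derivedSeries_le_derivedSeries (Φ.comp (FreeGroup.map e.symm)) 2
            (Subgroup.mem_map_of_mem _ hx)
          rw [hW] at this
          exact this
      have h4 : Φ (FreeGroup.map e.symm (FreeGroup.map q w)) = 1 := hle hw1
      have h5 : (e.symm : Fin n → _) ∘ q = Sum.inr := by
        funext j
        simp only [Function.comp]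
        rw [Equiv.symm_apply_eq, heq]
      rw [FreeGroup.map.comp, h5] at h4
      exact (QuotientGroup.eq_one_iff w).mpr (hΦ' w h4)
    · have h6 : (QuotientGroup.lift _ f hf).range = f.range := by
        ext x
        constructor
        · rintro ⟨y, rfl⟩
          induction y using QuotientGroup.induction_on with
          | H w => exact ⟨w, rfl⟩
        · rintro ⟨w, rfl⟩
          exact ⟨QuotientGroup.mk w, rfl⟩
      rw [h6, MonoidHom.range_eq_map, ← FreeGroup.closure_range_of, MonoidHom.map_closure, hH,
        ← Set.range_comp]
      congr 1
  · intro g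
    have h7 : H ⊔ Subgroup.normalClosure (K : Set (MetabelianPresented S)) = ⊤ := by
      rw [eq_top_iff, ← htop]
      exact sup_le_sup_left Subgroup.le_normalClosure H
    have h8 : g ∈ H ⊔ Subgroup.normalClosure (K : Set (MetabelianPresented S)) := by
      rw [h7]; trivial
    obtain ⟨h, hh, l, hl, rfl⟩ := Subgroup.mem_sup_of_normal_right.mp h8
    exact ⟨h, hh, l, hl, rfl⟩
end
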